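/- Let U be an open set in ℝⁿ, n ≥ 3, let x₀ ∈ ℝⁿ, and let φ: [0,∞) → [0,∞) be increasing with ∫₁^∞ (t/φ(t))^{1/(n−2)} dt < ∞. Then every continuous mapping f: U → ℝᵐ, m ≥ 1, in the class W^{1,φ}_loc has the following property: for almost every r > 0 (with respect to Lebesgue measure on radii), the restriction of f to the sphere S(x₀,r) ∩ U satisfies the Lusin (N)-property with respect to (n−1)-dimensional Hausdorff measure (indeed it is locally absolutely continuous there); moreover, for almost every such r, if E ⊆ S(x₀,r) ∩ U and |∇f| = 0 on E, then H^{n−1}(f(E)) = 0. -/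

import Mathlib

open MeasureTheory Set Metric Topology ENNReal

noncomputable section

abbrev Euc (n : ℕ) : Type := EuclideanSpace ℝ (Fin n)

/-- `Df` is a weak (distributional) Jacobian of `f` on the open set `Ω`, and both `f` and
`Df` are locally integrable on `Ω`; this encodes `f ∈ W^{1,1}_loc(Ω)` with weak derivative `Df`. -/
def IsWeakFDerivOn {n m : ℕ} (Ω : Set (Euc n)) (f : Euc n → Euc m)
    (Df : Euc n → (Euc n →L[ℝ] Euc m)) : Prop :=
  LocallyIntegrableOn f Ω volume ∧
  LocallyIntegrableOn (fun x => Df x) Ω volume ∧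
  ∀ ψ : Euc n → ℝ, ContDiff ℝ (⊤ : ℕ∞) ψ → HasCompactSupport ψ → tsupport ψ ⊆ Ω →
    ∀ v : Euc n, ∫ x in Ω, ψ x • Df x v = - ∫ x in Ω, (fderiv ℝ ψ x v) • f x

/-- The "gradient norm" `|∇f| = sqrt (Σ_{i,j} (∂f_i/∂x_j)²)` of a Jacobian matrix. -/
def frobNorm {n m : ℕ} (A : Euc n →L[ℝ] Euc m) : ℝ :=
  Real.sqrt (∑ i : Fin m, ∑ j : Fin n, (A (EuclideanSpace.single j (1:ℝ)) i) ^ 2)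

/- The dilatation `K_{p,f}(x)` built from the Jacobian matrix `A = f'(x)`:
`‖A‖^p / det A` if `det A ≠ 0`, `1` if `A = 0`, and `∞` otherwise. -/
open Classical in
def dilatation {n : ℕ} (p : ℝ) (A : Euc n →L[ℝ] Euc n) : ℝ≥0∞ :=
  if LinearMap.det (A : Euc n →ₗ[ℝ] Euc n) ≠ 0 then
    ENNReal.ofReal (‖A‖ ^ p / LinearMap.det (A : Euc n →ₗ[ℝ] Euc n))
  else if A = 0 then 1 else ⊤

/-- The Calderón-type condition `∫₁^∞ (t/φ(t))^{1/(n-2)} dt < ∞`. -/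
def CalderonCondition (n : ℕ) (φ : ℝ → ℝ) : Prop :=
  ∫⁻ t in Ioi (1:ℝ), (ENNReal.ofReal t / ENNReal.ofReal (φ t)) ^ (1 / ((n : ℝ) - 2)) < ⊤

/-- `f` belongs to the Orlicz–Sobolev class `W^{1,φ}_loc(Ω)` with weak Jacobian `Df`. -/
def MemOrliczSobolevWith {n m : ℕ} (φ : ℝ → ℝ) (Ω : Set (Euc n)) (f : Euc n → Euc m)
    (Df : Euc n → (Euc n →L[ℝ] Euc m)) : Prop :=
  IsWeakFDerivOn Ω f Df ∧
  ∀ K : Set (Euc n), K ⊆ Ω → IsCompact K →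
    ∫⁻ x in K, ENNReal.ofReal (φ (frobNorm (Df x))) ∂volume < ⊤

/-- The Lusin (N)-property of `f` on the set `A` with respect to the `d`-dimensional
Hausdorff measure. -/
def LusinNOn {n m : ℕ} (f : Euc n → Euc m) (A : Set (Euc n)) (d : ℝ) : Prop :=
  ∀ B ⊆ A, μH[d] B = 0 → μH[d] (f '' B) = 0

/-- `f` is locally absolutely continuous on the set `A` with respect to the `d`-dimensional
Hausdorff measure. -/
def LocAbsContOn {n m : ℕ} (f : Euc n → Euc m) (A : Set (Euc n)) (d : ℝ) : Prop :=
  ∀ x ∈ A, ∃ U : Set (Euc n), IsOpen U ∧ x ∈ U ∧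
    ∀ ε : ℝ, 0 < ε → ∃ δ : ℝ, 0 < δ ∧
      ∀ B ⊆ A ∩ U, μH[d] B < ENNReal.ofReal δ → μH[d] (f '' B) < ENNReal.ofReal ε

open scoped Convolution

theorem lintegral_homothety_le {k : ℕ} (x : Fin k → ℝ) {s : ℝ} (hs : 0 < s) (hs1 : s ≤ 1)
    {Q : Set (Fin k → ℝ)} (hQ : Convex ℝ Q) (hQm : MeasurableSet Q) (hx : x ∈ Q)
    {h : (Fin k → ℝ) → ℝ≥0∞} (hm : Measurable h) :
    ∫⁻ y in Q, h (x + s • (y - x)) ≤ (ENNReal.ofReal (s ^ k))⁻¹ * ∫⁻ z in Q, h z := by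
  have hT : ∀ y : Fin k → ℝ, x + s • (y - x) = (x - s • x) + s • y := fun y => by
    rw [smul_sub]; abel
  calc ∫⁻ y in Q, h (x + s • (y - x))
      = ∫⁻ y in Q, Q.indicator h ((x - s • x) + s • y) := by
        refine setLIntegral_congr_fun hQm fun y hy => ?_
        simp only [← hT]
        rw [indicator_of_mem]
        exact hQ.add_smul_sub_mem hx hy ⟨hs.le, hs1⟩
    _ ≤ ∫⁻ y, Q.indicator h ((x - s • x) + s • y) := setLIntegral_le_lintegral _ _
    _ = ∫⁻ z, Q.indicator h ((x - s • x) + z) ∂(Measure.map (s • ·) volume) := by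
        exact (lintegral_map ((hm.indicator hQm).comp (measurable_const_add (x - s • x)))
          (measurable_const_smul s)).symm
    _ = (ENNReal.ofReal (s ^ k))⁻¹ * ∫⁻ z in Q, h z := by
        rw [Measure.map_addHaar_smul _ hs.ne', lintegral_smul_measure,
          lintegral_add_left_eq_self (Q.indicator h), lintegral_indicator hQm]
        simp only [Module.finrank_fintype_fun_eq_card, Fintype.card_fin, smul_eq_mul]
        rw [abs_of_pos (by positivity), ENNReal.ofReal_inv_of_pos (by positivity)]

/-- Mean value over `s` of the measure of the part of `Q` sent into `A` by the homothety of
centre `x` and ratio `s`. -/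
theorem lintegral_homothety_indicator_le {k : ℕ} (hk : 2 ≤ k) (x : Fin k → ℝ)
    {Q : Set (Fin k → ℝ)} (hQ : Convex ℝ Q) (hQm : MeasurableSet Q) (hx : x ∈ Q)
    {V : ℝ} (hV : 0 < V) (hQV : volume Q = ENNReal.ofReal (V ^ k))
    {A : Set (Fin k → ℝ)} (hA : MeasurableSet A) :
    ∫⁻ s in Ioc (0 : ℝ) 1, ∫⁻ y in Q, A.indicator 1 (x + s • (y - x)) ≤
      2 * volume Q * (volume (A ∩ Q) ^ (1 / (k : ℝ)) / ENNReal.ofReal V) := by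
  have hQtop : volume Q ≠ ∞ := by simp [hQV]
  have hAtop : volume (A ∩ Q) ≠ ∞ := measure_ne_top_of_subset inter_subset_right hQtop
  have hk0 : (k : ℝ) ≠ 0 := by positivity
  have hk2 : (2 : ℝ) ≤ k := by exact_mod_cast hk
  -- the radius of a cube of the same volume as `A ∩ Q`, relative to `V`
  set b : ℝ := (volume (A ∩ Q)).toReal ^ (1 / (k : ℝ)) / V with hb
  have hb0 : 0 ≤ b := by positivity
  have hbk : (volume (A ∩ Q)).toReal = (b * V) ^ k := by
    rw [hb, div_mul_cancel₀ _ hV.ne', one_div, Real.rpow_inv_natCast_pow (by positivity) (by omega)]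
  have hAb : volume (A ∩ Q) = ENNReal.ofReal ((b * V) ^ k) := by
    rw [← hbk, ENNReal.ofReal_toReal hAtop]
  have hb' : volume (A ∩ Q) ^ (1 / (k : ℝ)) / ENNReal.ofReal V = ENNReal.ofReal b := by
    rw [hb, ENNReal.ofReal_div_of_pos hV, ← ENNReal.ofReal_rpow_of_nonneg (by positivity)
      (by positivity), ENNReal.ofReal_toReal hAtop]
  have h1 : ∀ s : ℝ, ∫⁻ y in Q, A.indicator 1 (x + s • (y - x)) ≤ volume Q := fun s =>
    calc ∫⁻ y in Q, A.indicator 1 (x + s • (y - x)) ≤ ∫⁻ y in Q, 1 :=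
          lintegral_mono fun y => indicator_le_self' (fun _ _ => zero_le) _
      _ = volume Q := by simp
  have h2 : ∀ s : ℝ, 0 < s → s ≤ 1 → ∫⁻ y in Q, A.indicator 1 (x + s • (y - x)) ≤
      volume Q * ENNReal.ofReal (b ^ k * s ^ (-(k : ℝ))) := fun s hs hs1 =>
    calc ∫⁻ y in Q, A.indicator 1 (x + s • (y - x))
        ≤ (ENNReal.ofReal (s ^ k))⁻¹ * ∫⁻ z in Q, A.indicator 1 z :=
          lintegral_homothety_le x hs hs1 hQ hQm hx (measurable_one.indicator hA)
      _ = volume Q * ENNReal.ofReal (b ^ k * s ^ (-(k : ℝ))) := by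
          rw [lintegral_indicator_one hA, Measure.restrict_apply hA, hAb, hQV,
            ← ENNReal.ofReal_inv_of_pos (by positivity), ← ENNReal.ofReal_mul (by positivity),
            ← ENNReal.ofReal_mul (by positivity), Real.rpow_neg hs.le, Real.rpow_natCast]
          congr 1; ring
  rw [hb']
  rcases hb0.eq_or_lt with hb00 | hbpos
  · have : ∫⁻ s in Ioc (0 : ℝ) 1, ∫⁻ y in Q, A.indicator 1 (x + s • (y - x)) ≤
      ∫⁻ s in Ioc (0 : ℝ) 1, 0 := by
      refine setLIntegral_mono measurable_const fun s hs => (h2 s hs.1 hs.2).trans ?_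
      simp [← hb00, show k ≠ 0 by omega]
    refine this.trans (by simp)
  · have hsub : Ioc (0 : ℝ) 1 ⊆ Ioc 0 b ∪ Ioi b ∩ Ioc 0 1 := fun s hs => by
      rcases le_or_gt s b with h | h
      · exact Or.inl ⟨hs.1, h⟩
      · exact Or.inr ⟨h, hs⟩
    have hint : IntegrableOn (fun s : ℝ => b ^ k * s ^ (-(k : ℝ))) (Ioi b) :=
      (integrableOn_Ioi_rpow_of_lt (by linarith) hbpos).const_mul _
    have htail : ∫⁻ s in Ioi b, ENNReal.ofReal (b ^ k * s ^ (-(k : ℝ))) ≤ ENNReal.ofReal b := by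
      rw [← ofReal_integral_eq_lintegral_ofReal hint
        ((ae_restrict_mem measurableSet_Ioi).mono fun s hs => by
          have : 0 < s := hbpos.trans hs
          positivity)]
      refine ENNReal.ofReal_le_ofReal ?_
      rw [integral_const_mul, integral_Ioi_rpow_of_lt (by linarith) hbpos, neg_div,
        ← div_neg, neg_add, neg_neg, Real.rpow_add hbpos, Real.rpow_neg hbpos.le, Real.rpow_one,
        Real.rpow_natCast]
      field_simp
      rw [div_le_one (by linarith)]
      linarith
    calc ∫⁻ s in Ioc (0 : ℝ) 1, ∫⁻ y in Q, A.indicator 1 (x + s • (y - x))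
        ≤ (∫⁻ s in Ioc 0 b, ∫⁻ y in Q, A.indicator 1 (x + s • (y - x))) +
          ∫⁻ s in Ioi b ∩ Ioc 0 1, ∫⁻ y in Q, A.indicator 1 (x + s • (y - x)) :=
          (lintegral_mono_set hsub).trans (lintegral_union_le _ _ _)
      _ ≤ (∫⁻ s in Ioc 0 b, volume Q) +
          ∫⁻ s in Ioi b ∩ Ioc 0 1, volume Q * ENNReal.ofReal (b ^ k * s ^ (-(k : ℝ))) := by
          refine add_le_add (lintegral_mono fun s => h1 s) ?_
          exact setLIntegral_mono' (measurableSet_Ioi.inter measurableSet_Ioc)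
            fun s hs => h2 s hs.2.1 hs.2.2
      _ ≤ volume Q * ENNReal.ofReal b + volume Q * ENNReal.ofReal b := by
          refine add_le_add (by simp) ?_
          rw [lintegral_const_mul' _ _ hQtop]
          exact mul_le_mul_right ((lintegral_mono_set inter_subset_left).trans htail) _
      _ = 2 * volume Q * ENNReal.ofReal b := by ring

/-- Dyadic level intervals covering `(0, ∞)`. -/
def levelIoc : ℕ → Set ℝ
  | 0 => Ioc 0 2
  | j + 1 => Ioc (2 ^ (j + 1)) (2 ^ (j + 2))

theorem measurableSet_levelIoc (j : ℕ) : MeasurableSet (levelIoc j) := by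
  cases j <;> exact measurableSet_Ioc

theorem exists_mem_levelIoc {t : ℝ} (ht : 0 < t) : ∃ j, t ∈ levelIoc j ∧ t ≤ 2 ^ (j + 1) := by
  rcases le_or_gt t 2 with h | h
  · exact ⟨0, ⟨ht, h⟩, by simpa using h⟩
  · obtain ⟨j, hj⟩ := exists_mem_Ioc_zpow ht one_lt_two
    have hj0 : 0 < j := by
      by_contra hcon
      have : (2 : ℝ) ^ (j + 1) ≤ 2 ^ (1 : ℤ) := zpow_le_zpow_right₀ one_le_two (by omega)
      have := hj.2
      norm_num at *
      linarith
    obtain ⟨i, rfl⟩ : ∃ i : ℕ, j = i + 1 := ⟨(j - 1).toNat, by omega⟩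
    refine ⟨i + 1, ⟨?_, ?_⟩, ?_⟩
    · exact_mod_cast hj.1
    · exact_mod_cast hj.2
    · exact_mod_cast hj.2

theorem pow_lt_of_mem_levelIoc {t : ℝ} {j : ℕ} (h : t ∈ levelIoc (j + 1)) : 2 ^ (j + 1) < t := h.1

theorem le_pow_of_mem_levelIoc {t : ℝ} {j : ℕ} (h : t ∈ levelIoc j) : t ≤ 2 ^ (j + 1) := by
  cases j with
  | zero => simpa using h.2
  | succ j => exact h.2

theorem pairwise_disjoint_levelIoc {t : ℝ} {i j : ℕ} (hi : t ∈ levelIoc i) (hj : t ∈ levelIoc j) :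
    i = j := by
  wlog h : i < j generalizing i j
  · rcases lt_trichotomy i j with h' | h' | h'
    · exact this hi hj h'
    · exact h'
    · exact (this hj hi h').symm
  obtain ⟨l, rfl⟩ : ∃ l, j = l + 1 := ⟨j - 1, by omega⟩
  have h1 := pow_lt_of_mem_levelIoc hj
  have h2 := le_pow_of_mem_levelIoc hi
  have : (2 : ℝ) ^ (i + 1) ≤ 2 ^ (l + 1) := pow_le_pow_right₀ one_le_two (by omega)
  linarith

/-- The step function with value `w j` on the `j`-th dyadic level and `0` outside `(0, ∞)`. -/
def levelWeight (w : ℕ → ℝ≥0∞) (t : ℝ) : ℝ≥0∞ := ∑' j, w j * (levelIoc j).indicator 1 t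

theorem measurable_levelWeight (w : ℕ → ℝ≥0∞) : Measurable (levelWeight w) :=
  Measurable.tsum fun j =>
    (measurable_one.indicator (measurableSet_levelIoc j)).const_mul _

theorem levelWeight_of_mem (w : ℕ → ℝ≥0∞) {t : ℝ} {j : ℕ} (h : t ∈ levelIoc j) :
    levelWeight w t = w j := by
  rw [levelWeight, tsum_eq_single j]
  · simp [h]
  · intro i hi
    rw [indicator_of_notMem fun h' => hi (pairwise_disjoint_levelIoc h' h), mul_zero]

theorem levelWeight_of_nonpos (w : ℕ → ℝ≥0∞) {t : ℝ} (ht : t ≤ 0) : levelWeight w t = 0 := by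
  rw [levelWeight, ENNReal.tsum_eq_zero]
  intro j
  rw [indicator_of_notMem, mul_zero]
  cases j with
  | zero => exact fun h => absurd h.1 (not_lt.2 ht)
  | succ j =>
    intro h
    have : (0 : ℝ) < 2 ^ (j + 1) := by positivity
    linarith [h.1]

theorem ofReal_le_levelWeight (t : ℝ) : ENNReal.ofReal t ≤ levelWeight (fun j => 2 ^ (j + 1)) t := by
  rcases le_or_gt t 0 with h | h
  · simp [ENNReal.ofReal_of_nonpos h]
  · obtain ⟨j, hj, hj'⟩ := exists_mem_levelIoc h
    rw [levelWeight_of_mem _ hj]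
    calc ENNReal.ofReal t ≤ ENNReal.ofReal (2 ^ (j + 1)) := ENNReal.ofReal_le_ofReal hj'
      _ = 2 ^ (j + 1) := by rw [ENNReal.ofReal_pow zero_le_two]; simp

/-- The constants appearing in the discrete Hölder inequality below. -/
def calderonCoeff (k : ℕ) (w : ℕ → ℝ≥0∞) (j : ℕ) : ℝ≥0∞ :=
  ((2 ^ (j + 1)) ^ k / w j) ^ (1 / ((k : ℝ) - 1))

theorem tsum_level_rpow_le {k : ℕ} (hk : 2 ≤ k) (w a : ℕ → ℝ≥0∞) (hw0 : ∀ j, w j ≠ 0)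
    (hwt : ∀ j, w j ≠ ∞) :
    (∑' j, 2 ^ (j + 1) * a j ^ (1 / (k : ℝ))) ^ k ≤
      (∑' j, calderonCoeff k w j) ^ (k - 1) * ∑' j, w j * a j := by
  have hk2 : (2 : ℝ) ≤ k := by exact_mod_cast hk
  have hk1 : (0 : ℝ) < (k : ℝ) - 1 := by linarith
  have hk0 : (0 : ℝ) < k := by linarith
  have hconj : ((k : ℝ) / (k - 1)).HolderConjugate k := by
    rw [Real.holderConjugate_iff]
    constructor
    · rw [one_lt_div hk1]; linarith
    · field_simp; ring
  have key := ENNReal.lintegral_mul_le_Lp_mul_Lq (Measure.count : Measure ℕ) hconj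
    (f := fun j => 2 ^ (j + 1) * (w j) ^ (-(1 / (k : ℝ))))
    (g := fun j => (w j * a j) ^ (1 / (k : ℝ))) (by fun_prop) (by fun_prop)
  simp only [lintegral_count, Pi.mul_apply] at key
  have e1 : ∀ j, 2 ^ (j + 1) * (w j) ^ (-(1 / (k : ℝ))) * (w j * a j) ^ (1 / (k : ℝ)) =
      2 ^ (j + 1) * a j ^ (1 / (k : ℝ)) := fun j => by
    rw [ENNReal.mul_rpow_of_nonneg _ _ (by positivity), mul_assoc, ← mul_assoc (w j ^ _),
      ← ENNReal.rpow_add _ _ (hw0 j) (hwt j)]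
    simp
  have e2 : ∀ j, (2 ^ (j + 1) * (w j) ^ (-(1 / (k : ℝ)))) ^ ((k : ℝ) / (k - 1)) =
      calderonCoeff k w j := fun j => by
    rw [calderonCoeff, show (k : ℝ) / (k - 1) = k * (1 / ((k : ℝ) - 1)) by ring, ENNReal.rpow_mul]
    congr 1
    rw [ENNReal.mul_rpow_of_nonneg _ _ hk0.le, ← ENNReal.rpow_mul,
      ENNReal.rpow_natCast, show -(1 / (k : ℝ)) * k = -1 by field_simp, ENNReal.rpow_neg_one,
      div_eq_mul_inv]
  have e3 : ∀ j, ((w j * a j) ^ (1 / (k : ℝ))) ^ (k : ℝ) = w j * a j := fun j => by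
    rw [← ENNReal.rpow_mul, one_div_mul_cancel hk0.ne', ENNReal.rpow_one]
  simp only [e1, e2, e3] at key
  calc (∑' j, 2 ^ (j + 1) * a j ^ (1 / (k : ℝ))) ^ k
      ≤ ((∑' j, calderonCoeff k w j) ^ (1 / ((k : ℝ) / (k - 1))) *
          (∑' j, w j * a j) ^ (1 / (k : ℝ))) ^ k := by gcongr
    _ = (∑' j, calderonCoeff k w j) ^ (k - 1) * ∑' j, w j * a j := by
      rw [mul_pow, ← ENNReal.rpow_natCast, ← ENNReal.rpow_natCast, ← ENNReal.rpow_mul,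
        ← ENNReal.rpow_mul, one_div_mul_cancel hk0.ne', ENNReal.rpow_one,
        show 1 / ((k : ℝ) / (k - 1)) * k = ((k - 1 : ℕ) : ℝ) by
          rw [Nat.cast_sub (by omega)]; field_simp; simp, ENNReal.rpow_natCast]

/-- Calderón-type oscillation estimate on a cube. -/
theorem edist_pow_le_of_lintegral_segment_le {k : ℕ} (hk : 2 ≤ k) {F : Type*} [PseudoMetricSpace F]
    {u : (Fin k → ℝ) → F} {p : (Fin k → ℝ) → ℝ} (hp : Measurable p) {L : ℝ≥0∞}
    {w : ℕ → ℝ≥0∞} (hw0 : ∀ j, w j ≠ 0) (hwt : ∀ j, w j ≠ ∞)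
    {c : Fin k → ℝ} {ρ : ℝ} (hρ : 0 < ρ) (hu : ContinuousOn u (closedBall c ρ))
    (H : ∀ x ∈ closedBall c ρ, ∫⁻ y in closedBall c ρ, edist (u y) (u x) ≤
      ENNReal.ofReal (2 * ρ) * ∫⁻ s in Ioc (0 : ℝ) 1, ∫⁻ y in closedBall c ρ,
        L * ENNReal.ofReal (p (x + s • (y - x))))
    {x x' : Fin k → ℝ} (hx : x ∈ closedBall c ρ) (hx' : x' ∈ closedBall c ρ) :
    edist (u x) (u x') ^ k ≤ (4 * L) ^ k * (∑' j, calderonCoeff k w j) ^ (k - 1) *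
      ∫⁻ z in closedBall c ρ, levelWeight w (p z) := by
  set Q := closedBall c ρ with hQdef
  have hQm : MeasurableSet Q := isClosed_closedBall.measurableSet
  have hQc : Convex ℝ Q := convex_closedBall c ρ
  have hQV : volume Q = ENNReal.ofReal ((2 * ρ) ^ k) := by
    rw [hQdef, Real.volume_pi_closedBall _ hρ.le, Fintype.card_fin]
  have hQ0 : volume Q ≠ 0 := by
    rw [hQV]; simp only [ne_eq, ENNReal.ofReal_eq_zero, not_le]; positivity
  have hQt : volume Q ≠ ∞ := by simp [hQV]
  have hAm : ∀ j, MeasurableSet (p ⁻¹' levelIoc j) := fun j => hp (measurableSet_levelIoc j)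
  set S := ∑' j, 2 ^ (j + 1) * volume (p ⁻¹' levelIoc j ∩ Q) ^ (1 / (k : ℝ)) with hS
  have hcont : ∀ (x : Fin k → ℝ) (s : ℝ), Measurable (fun y : Fin k → ℝ => x + s • (y - x)) := fun x s =>
    (by fun_prop : Continuous fun y : Fin k → ℝ => x + s • (y - x)).measurable
  have hcont2 : ∀ x : Fin k → ℝ, Measurable (fun q : ℝ × (Fin k → ℝ) => x + q.1 • (q.2 - x)) :=
    fun x => (by fun_prop : Continuous fun q : ℝ × (Fin k → ℝ) => x + q.1 • (q.2 - x)).measurable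
  have hind : ∀ (j : ℕ) (z : Fin k → ℝ), (levelIoc j).indicator (1 : ℝ → ℝ≥0∞) (p z) =
      (p ⁻¹' levelIoc j).indicator 1 z := fun j z => by
    by_cases hz : p z ∈ levelIoc j <;> simp [indicator, hz]
  have T : ∀ x ∈ Q, ∫⁻ y in Q, edist (u y) (u x) ≤ 2 * L * volume Q * S := fun x hx => by
    refine (H x hx).trans ?_
    calc ENNReal.ofReal (2 * ρ) * ∫⁻ s in Ioc (0 : ℝ) 1, ∫⁻ y in Q,
          L * ENNReal.ofReal (p (x + s • (y - x)))
        ≤ ENNReal.ofReal (2 * ρ) * ∫⁻ s in Ioc (0 : ℝ) 1, ∫⁻ y in Q, ∑' j,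
          L * 2 ^ (j + 1) * (p ⁻¹' levelIoc j).indicator 1 (x + s • (y - x)) := by
          gcongr with s y
          refine (mul_le_mul_right (ofReal_le_levelWeight _) L).trans (le_of_eq ?_)
          simp only [levelWeight, hind, ← ENNReal.tsum_mul_left, mul_assoc]
      _ = ENNReal.ofReal (2 * ρ) * ∑' j, L * 2 ^ (j + 1) * ∫⁻ s in Ioc (0 : ℝ) 1, ∫⁻ y in Q,
            (p ⁻¹' levelIoc j).indicator 1 (x + s • (y - x)) := by
          congr 1
          have hm1 : ∀ (j : ℕ) (s : ℝ), Measurable fun y : Fin k → ℝ =>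
              (p ⁻¹' levelIoc j).indicator (1 : (Fin k → ℝ) → ℝ≥0∞) (x + s • (y - x)) :=
            fun j s => (measurable_one.indicator (hAm j)).comp (hcont x s)
          have hm2 : ∀ j, Measurable fun s : ℝ => ∫⁻ y in Q,
              (p ⁻¹' levelIoc j).indicator (1 : (Fin k → ℝ) → ℝ≥0∞) (x + s • (y - x)) := fun j =>
            Measurable.lintegral_prod_right'
              (f := fun q : ℝ × (Fin k → ℝ) => (p ⁻¹' levelIoc j).indicator
                (1 : (Fin k → ℝ) → ℝ≥0∞) (x + q.1 • (q.2 - x)))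
              ((measurable_one.indicator (hAm j)).comp (hcont2 x))
          calc _ = ∫⁻ s in Ioc (0 : ℝ) 1, ∑' j, L * 2 ^ (j + 1) * ∫⁻ y in Q,
                (p ⁻¹' levelIoc j).indicator 1 (x + s • (y - x)) := by
                refine lintegral_congr fun s => ?_
                rw [lintegral_tsum fun j => ((hm1 j s).const_mul _).aemeasurable]
                congr 1; ext j
                rw [lintegral_const_mul _ (hm1 j s)]
            _ = _ := by
                rw [lintegral_tsum fun j => ((hm2 j).const_mul _).aemeasurable]
                congr 1; ext j
                rw [lintegral_const_mul _ (hm2 j)]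
      _ ≤ ENNReal.ofReal (2 * ρ) * ∑' j, L * 2 ^ (j + 1) * (2 * volume Q *
            (volume (p ⁻¹' levelIoc j ∩ Q) ^ (1 / (k : ℝ)) / ENNReal.ofReal (2 * ρ))) := by
          gcongr with j
          exact lintegral_homothety_indicator_le hk x hQc hQm hx (by positivity) hQV (hAm j)
      _ = 2 * L * volume Q * S := by
          rw [hS, ← ENNReal.tsum_mul_left, ← ENNReal.tsum_mul_left]
          congr 1; ext j
          have h0 : ENNReal.ofReal (2 * ρ) ≠ 0 := by simpa using hρ
          have e : ENNReal.ofReal (2 * ρ) * (ENNReal.ofReal (2 * ρ))⁻¹ = 1 :=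
            ENNReal.mul_inv_cancel h0 ENNReal.ofReal_ne_top
          calc _ = 2 * L * volume Q * (2 ^ (j + 1) *
                volume (p ⁻¹' levelIoc j ∩ Q) ^ (1 / (k : ℝ))) *
                (ENNReal.ofReal (2 * ρ) * (ENNReal.ofReal (2 * ρ))⁻¹) := by
                rw [div_eq_mul_inv]; ring
            _ = _ := by rw [e, mul_one]
  have hle : edist (u x) (u x') ≤ 4 * L * S := by
    have hm : AEMeasurable (fun y => edist (u y) (u x)) (volume.restrict Q) := by
      exact ((continuous_id.edist continuous_const).comp_continuousOn hu).aemeasurable hQm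
    have : edist (u x) (u x') * volume Q ≤ 4 * L * S * volume Q :=
      calc edist (u x) (u x') * volume Q = ∫⁻ y in Q, edist (u x) (u x') := by simp
        _ ≤ ∫⁻ y in Q, (edist (u y) (u x) + edist (u y) (u x')) :=
          lintegral_mono fun y => edist_triangle_left _ _ _
        _ = (∫⁻ y in Q, edist (u y) (u x)) + ∫⁻ y in Q, edist (u y) (u x') :=
          lintegral_add_left' hm _
        _ ≤ 2 * L * volume Q * S + 2 * L * volume Q * S := add_le_add (T x hx) (T x' hx')
        _ = 4 * L * S * volume Q := by ring
    exact (ENNReal.mul_le_mul_iff_left hQ0 hQt).1 this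
  calc edist (u x) (u x') ^ k ≤ (4 * L * S) ^ k := by gcongr
    _ = (4 * L) ^ k * S ^ k := mul_pow _ _ _
    _ ≤ (4 * L) ^ k * ((∑' j, calderonCoeff k w j) ^ (k - 1) *
          ∑' j, w j * volume (p ⁻¹' levelIoc j ∩ Q)) := by
        gcongr
        exact tsum_level_rpow_le hk w _ hw0 hwt
    _ = _ := by
        rw [mul_assoc]
        congr 2
        simp only [levelWeight, hind]
        rw [lintegral_tsum fun j => ((measurable_one.indicator (hAm j)).const_mul _).aemeasurable]
        congr 1; ext j
        rw [lintegral_const_mul _ (measurable_one.indicator (hAm j)),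
          lintegral_indicator_one (hAm j), Measure.restrict_apply (hAm j)]

/-- The values of `φ` at the dyadic points, as weights of the dyadic levels. -/
def dyadicWeight (φ : ℝ → ℝ) : ℕ → ℝ≥0∞
  | 0 => 1
  | j + 1 => ENNReal.ofReal (φ (2 ^ (j + 1)))

theorem dyadicWeight_ne_top (φ : ℝ → ℝ) (j : ℕ) : dyadicWeight φ j ≠ ∞ := by
  cases j <;> simp [dyadicWeight]

theorem levelWeight_dyadicWeight_le {φ : ℝ → ℝ} (hφ : MonotoneOn φ (Ici 0)) (t : ℝ) :
    levelWeight (dyadicWeight φ) t ≤ 1 + ENNReal.ofReal (φ t) := by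
  rcases le_or_gt t 0 with h | h
  · simp [levelWeight_of_nonpos _ h]
  · obtain ⟨j, hj, -⟩ := exists_mem_levelIoc h
    rw [levelWeight_of_mem _ hj]
    cases j with
    | zero => exact le_self_add
    | succ j =>
      refine le_add_left (ENNReal.ofReal_le_ofReal (hφ ?_ h.le (pow_lt_of_mem_levelIoc hj).le))
      exact (by positivity : (0 : ℝ) ≤ 2 ^ (j + 1))

theorem tsum_calderonCoeff_ne_top {k : ℕ} (hk : 2 ≤ k) {φ : ℝ → ℝ} (hφ : MonotoneOn φ (Ici 0))
    (h : ∫⁻ t in Ioi (1 : ℝ),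
      (ENNReal.ofReal t / ENNReal.ofReal (φ t)) ^ (1 / ((k : ℝ) - 1)) < ∞) :
    ∑' j, calderonCoeff k (dyadicWeight φ) j ≠ ∞ := by
  have hk2 : (2 : ℝ) ≤ k := by exact_mod_cast hk
  have hk1 : (0 : ℝ) < (k : ℝ) - 1 := by linarith
  set e : ℝ := 1 / ((k : ℝ) - 1) with he
  have he0 : 0 < e := by positivity
  have hpow : ∀ j : ℕ, ENNReal.ofReal (2 ^ j) = 2 ^ j := fun j => by
    rw [ENNReal.ofReal_pow zero_le_two]; simp
  have hterm : ∀ j : ℕ, calderonCoeff k (dyadicWeight φ) (j + 1) ≤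
      (4 ^ k) ^ e * ∫⁻ t in Ioc ((2 : ℝ) ^ j) (2 ^ (j + 1)),
        (ENNReal.ofReal t / ENNReal.ofReal (φ t)) ^ e := fun j => by
    have hle : (2 : ℝ) ^ j ≤ 2 ^ (j + 1) := pow_le_pow_right₀ one_le_two (by omega)
    have h0 : (0 : ℝ) < 2 ^ j := by positivity
    calc calderonCoeff k (dyadicWeight φ) (j + 1)
        = (4 ^ k) ^ e * (2 ^ j * (2 ^ j / ENNReal.ofReal (φ (2 ^ (j + 1)))) ^ e) := by
          have h1 : (2 : ℝ≥0∞) ^ j = ((2 ^ j) ^ (k - 1)) ^ e := by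
            rw [← ENNReal.rpow_natCast _ (k - 1), ← ENNReal.rpow_mul, Nat.cast_sub (by omega),
              Nat.cast_one, he, mul_one_div_cancel hk1.ne', ENNReal.rpow_one]
          nth_rw 1 [h1]
          rw [← ENNReal.mul_rpow_of_nonneg _ _ he0.le, ← ENNReal.mul_rpow_of_nonneg _ _ he0.le,
            calderonCoeff, ← he, dyadicWeight]
          congr 1
          rw [div_eq_mul_inv, div_eq_mul_inv, ← mul_assoc, ← mul_assoc]
          congr 1
          rw [mul_assoc, ← pow_succ, show k - 1 + 1 = k by omega, ← mul_pow]
          congr 1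
          rw [pow_succ, pow_succ]; ring_nf
      _ = (4 ^ k) ^ e * ∫⁻ t in Ioc ((2 : ℝ) ^ j) (2 ^ (j + 1)),
            (2 ^ j / ENNReal.ofReal (φ (2 ^ (j + 1)))) ^ e := by
          rw [setLIntegral_const, Real.volume_Ioc, show (2 : ℝ) ^ (j + 1) - 2 ^ j = 2 ^ j by ring,
            hpow, mul_comm (2 ^ j : ℝ≥0∞)]
      _ ≤ _ := by
          refine mul_le_mul_right (setLIntegral_mono' measurableSet_Ioc fun t ht => ?_) _
          have ht0 : 0 < t := h0.trans ht.1
          gcongr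
          · rw [← hpow]; exact ENNReal.ofReal_le_ofReal ht.1.le
          · exact hφ ht0.le (ht0.le.trans ht.2) ht.2
  rw [tsum_eq_zero_add' ENNReal.summable]
  refine ENNReal.add_ne_top.2 ⟨?_, ne_top_of_le_ne_top ?_ (ENNReal.tsum_le_tsum hterm)⟩
  · simp only [calderonCoeff, dyadicWeight, div_one, ← he]
    exact ENNReal.rpow_ne_top_of_nonneg he0.le (by finiteness)
  · have hdisj : Pairwise (Function.onFun Disjoint
        fun j : ℕ => Ioc ((2 : ℝ) ^ j) (2 ^ (j + 1))) :=
      Monotone.pairwise_disjoint_on_Ioc_succ (pow_right_mono₀ (one_le_two (α := ℝ)))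
    rw [ENNReal.tsum_mul_left, ← lintegral_iUnion (fun j => measurableSet_Ioc) hdisj]
    refine ENNReal.mul_ne_top (ENNReal.rpow_ne_top_of_nonneg he0.le (by finiteness)) ?_
    refine ne_top_of_le_ne_top h.ne (lintegral_mono_set (iUnion_subset fun j t ht => ?_))
    exact (one_le_pow₀ (one_le_two (α := ℝ))).trans_lt ht.1

theorem dyadicWeight_ne_zero {k : ℕ} (hk : 2 ≤ k) {φ : ℝ → ℝ}
    (h : ∑' j, calderonCoeff k (dyadicWeight φ) j ≠ ∞) (j : ℕ) : dyadicWeight φ j ≠ 0 := by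
  intro hj
  refine ENNReal.ne_top_of_tsum_ne_top h j ?_
  have hk2 : (2 : ℝ) ≤ k := by exact_mod_cast hk
  have hk1 : (0 : ℝ) < (k : ℝ) - 1 := by linarith
  rw [calderonCoeff, hj, ENNReal.div_zero (by simp), ENNReal.top_rpow_of_pos (by positivity)]

/-- A mapping whose oscillation on cubes is controlled by a finite measure has images whose
Hausdorff measure is controlled by this measure. -/
theorem hausdorffMeasure_image_le_of_edist_pow_le {k : ℕ} (hk : 0 < k) {F : Type*} [MetricSpace F]
    [MeasurableSpace F] [BorelSpace F] {u : (Fin k → ℝ) → F} {O : Set (Fin k → ℝ)} (hO : IsOpen O)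
    (hu : ContinuousOn u O) (ν : Measure (Fin k → ℝ)) [IsFiniteMeasure ν] {C : ℝ≥0∞} (hC : C ≠ ∞)
    (H : ∀ c ρ, 0 < ρ → closedBall c ρ ⊆ O → ∀ x ∈ closedBall c ρ, ∀ x' ∈ closedBall c ρ,
      edist (u x) (u x') ^ k ≤ C * ν (closedBall c ρ))
    {B : Set (Fin k → ℝ)} (hB : B ⊆ O) : μH[k] (u '' B) ≤ C * ν B := by
  have hk0 : (0 : ℝ) < k := by exact_mod_cast hk
  set η : ℕ → ℝ≥0∞ := fun i => ((i : ℝ≥0∞) + 1)⁻¹ with hη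
  have hη0 : ∀ i, η i ≠ 0 := fun i => by simp [hη]
  have hηlim : Filter.Tendsto η Filter.atTop (𝓝 0) := by
    have := ENNReal.tendsto_inv_nat_nhds_zero.comp (Filter.tendsto_add_atTop_nat 1)
    refine this.congr fun i => ?_
    simp [hη]
  have hcov : ∀ i : ℕ, ∃ (t : Set (Fin k → ℝ)) (r : (Fin k → ℝ) → ℝ), t.Countable ∧ t ⊆ B ∧
      (∀ x ∈ t, r x ∈ {ρ : ℝ | 0 < ρ ∧ closedBall x ρ ⊆ O ∧
        ∀ y ∈ closedBall x ρ, edist (u y) (u x) ≤ η i / 2}) ∧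
      (B ⊆ ⋃ x ∈ t, closedBall x (r x)) ∧
      (∑' x : t, ν (closedBall x (r x))) ≤ ν B + η i := fun i => by
    refine Besicovitch.exists_closedBall_covering_tsum_measure_le ν (hη0 i) _ B fun x hx δ hδ => ?_
    have hxO := hO.mem_nhds (hB hx)
    have hev : ∀ᶠ y in 𝓝 x, y ∈ O ∧ edist (u y) (u x) < η i / 2 :=
      (Filter.eventually_of_mem hxO fun _ h => h).and
        ((hu.continuousAt hxO).eventually
          (Metric.eball_mem_nhds (u x) (ENNReal.half_pos (hη0 i))))
    obtain ⟨R, hR, hRb⟩ := Metric.eventually_nhds_iff_ball.1 hev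
    refine ⟨min R δ / 2, ⟨by positivity, fun y hy => ?_, fun y hy => ?_⟩, by positivity, ?_⟩
    · refine (hRb y (closedBall_subset_ball ?_ hy)).1
      linarith [min_le_left R δ, lt_min hR hδ]
    · refine (hRb y (closedBall_subset_ball ?_ hy)).2.le
      linarith [min_le_left R δ, lt_min hR hδ]
    · linarith [min_le_right R δ, lt_min hR hδ]
  choose t r htc htB hr hBt hsum using hcov
  have : ∀ i, Countable (t i) := fun i => (htc i).to_subtype
  have hdiam := Measure.hausdorffMeasure_le_liminf_tsum (k : ℝ) (u '' B) η hηlim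
    (ι := fun i => t i) (fun i x => u '' closedBall (x : Fin k → ℝ) (r i x))
    (Filter.Eventually.of_forall fun i x => by
      refine Metric.ediam_le ?_
      rintro _ ⟨y, hy, rfl⟩ _ ⟨z, hz, rfl⟩
      calc edist (u y) (u z) ≤ edist (u y) (u x) + edist (u z) (u x) := edist_triangle_right _ _ _
        _ ≤ η i / 2 + η i / 2 := add_le_add ((hr i x x.2).2.2 y hy) ((hr i x x.2).2.2 z hz)
        _ = η i := ENNReal.add_halves _)
    (Filter.Eventually.of_forall fun i => by
      rintro _ ⟨y, hy, rfl⟩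
      obtain ⟨x, hx, hyx⟩ := mem_iUnion₂.1 (hBt i hy)
      exact mem_iUnion.2 ⟨⟨x, hx⟩, mem_image_of_mem u hyx⟩)
  refine hdiam.trans ?_
  have hlim : Filter.Tendsto (fun i => C * (ν B + η i)) Filter.atTop (𝓝 (C * (ν B + 0))) :=
    ENNReal.Tendsto.const_mul (tendsto_const_nhds.add hηlim) (Or.inr hC)
  rw [add_zero] at hlim
  rw [← hlim.liminf_eq]
  refine Filter.liminf_le_liminf (Filter.Eventually.of_forall fun i => ?_)
  calc ∑' x : t i, ediam (u '' closedBall (x : Fin k → ℝ) (r i x)) ^ (k : ℝ)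
      ≤ ∑' x : t i, C * ν (closedBall (x : Fin k → ℝ) (r i x)) := by
        refine ENNReal.tsum_le_tsum fun x => ?_
        rw [← ENNReal.le_rpow_inv_iff hk0]
        refine Metric.ediam_le ?_
        rintro _ ⟨y, hy, rfl⟩ _ ⟨z, hz, rfl⟩
        rw [ENNReal.le_rpow_inv_iff hk0, ENNReal.rpow_natCast]
        exact H x (r i x) (hr i x x.2).1 (hr i x x.2).2.1 y hy z hz
    _ = C * ∑' x : t i, ν (closedBall (x : Fin k → ℝ) (r i x)) := ENNReal.tsum_mul_left
    _ ≤ C * (ν B + η i) := mul_le_mul_right (hsum i) _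

theorem setLIntegral_le_of_tendsto {α : Type*} [MeasurableSpace α] {μ : Measure α} {s : Set α}
    (hs : MeasurableSet s) {f : ℕ → α → ℝ≥0∞} {g : α → ℝ≥0∞} {b : ℕ → ℝ≥0∞} {B : ℝ≥0∞}
    (hf : ∀ i, AEMeasurable (f i) (μ.restrict s))
    (hlim : ∀ x ∈ s, Filter.Tendsto (fun i => f i x) Filter.atTop (𝓝 (g x)))
    (hle : ∀ i, ∫⁻ x in s, f i x ∂μ ≤ b i) (hb : Filter.Tendsto b Filter.atTop (𝓝 B)) :
    ∫⁻ x in s, g x ∂μ ≤ B :=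
  calc ∫⁻ x in s, g x ∂μ = ∫⁻ x in s, Filter.liminf (fun i => f i x) Filter.atTop ∂μ :=
        setLIntegral_congr_fun hs fun x hx => (hlim x hx).liminf_eq.symm
    _ ≤ Filter.liminf (fun i => ∫⁻ x in s, f i x ∂μ) Filter.atTop := lintegral_liminf_le' hf
    _ ≤ Filter.liminf b Filter.atTop :=
        Filter.liminf_le_liminf (Filter.Eventually.of_forall hle)
    _ = B := hb.liminf_eq

theorem lintegral_edist_le_of_approx {k : ℕ} {F : Type*} [PseudoMetricSpace F]
    {c : Fin k → ℝ} {ρ : ℝ} {u : (Fin k → ℝ) → F}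
    (hu : ContinuousOn u (closedBall c ρ)) {v : ℕ → (Fin k → ℝ) → F}
    (hv : ∀ i, Continuous (v i))
    (hlim : ∀ z ∈ closedBall c ρ, Filter.Tendsto (fun i => v i z) Filter.atTop (𝓝 (u z)))
    {g : (Fin k → ℝ) → ℝ≥0∞} (hg : Measurable g) {h : ℕ → (Fin k → ℝ) → ℝ≥0∞}
    (hh : ∀ i, Measurable (h i))
    (hh0 : Filter.Tendsto (fun i => ∫⁻ z in closedBall c ρ, h i z) Filter.atTop (𝓝 0))
    (hseg : ∀ i, ∀ x ∈ closedBall c ρ, ∀ y ∈ closedBall c ρ, ∀ σ ∈ Ioo (0 : ℝ) 1,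
      edist (v i y) (v i (x + σ • (y - x))) ≤
        edist y x * ∫⁻ s in Ioc σ 1, (g (x + s • (y - x)) + h i (x + s • (y - x))))
    {x : Fin k → ℝ} (hx : x ∈ closedBall c ρ) :
    ∫⁻ y in closedBall c ρ, edist (u y) (u x) ≤
      ENNReal.ofReal (2 * ρ) * ∫⁻ s in Ioc (0 : ℝ) 1, ∫⁻ y in closedBall c ρ,
        g (x + s • (y - x)) := by
  set Q := closedBall c ρ with hQdef
  have hQm : MeasurableSet Q := isClosed_closedBall.measurableSet
  have hQc : Convex ℝ Q := convex_closedBall c ρ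
  have hmaps : ∀ σ ∈ Ioo (0 : ℝ) 1, ∀ y ∈ Q, x + σ • (y - x) ∈ Q := fun σ hσ y hy =>
    hQc.add_smul_sub_mem hx hy ⟨hσ.1.le, hσ.2.le⟩
  have hcontσ : ∀ σ : ℝ, Continuous fun y : Fin k → ℝ => x + σ • (y - x) := fun σ => by fun_prop
  have hcont2 : Measurable (fun q : ℝ × (Fin k → ℝ) => x + q.1 • (q.2 - x)) :=
    (by fun_prop : Continuous fun q : ℝ × (Fin k → ℝ) => x + q.1 • (q.2 - x)).measurable
  have hprod : ∀ {G : (Fin k → ℝ) → ℝ≥0∞}, Measurable G →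
      Measurable fun s : ℝ => ∫⁻ y in Q, G (x + s • (y - x)) := fun {G} hG =>
    Measurable.lintegral_prod_right' (f := fun q : ℝ × (Fin k → ℝ) => G (x + q.1 • (q.2 - x)))
      (hG.comp hcont2)
  have hdist : ∀ y ∈ Q, edist y x ≤ ENNReal.ofReal (2 * ρ) := fun y hy => by
    rw [edist_dist]
    refine ENNReal.ofReal_le_ofReal ?_
    linarith [dist_triangle_right y x c, mem_closedBall.1 hy, mem_closedBall.1 hx]
  have step1 : ∀ σ ∈ Ioo (0 : ℝ) 1, ∫⁻ y in Q, edist (u y) (u (x + σ • (y - x))) ≤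
      ENNReal.ofReal (2 * ρ) * ∫⁻ s in Ioc (0 : ℝ) 1, ∫⁻ y in Q, g (x + s • (y - x)) := by
    intro σ hσ
    have hσk : ENNReal.ofReal (σ ^ k) ≠ 0 := by
      have := hσ.1
      simp only [ne_eq, ENNReal.ofReal_eq_zero, not_le]; positivity
    refine setLIntegral_le_of_tendsto hQm (f := fun i y => edist (v i y) (v i (x + σ • (y - x))))
      (b := fun i => ENNReal.ofReal (2 * ρ) *
        ((∫⁻ s in Ioc (0 : ℝ) 1, ∫⁻ y in Q, g (x + s • (y - x))) +
          (ENNReal.ofReal (σ ^ k))⁻¹ * ∫⁻ z in Q, h i z)) (fun i => ?_) (fun y hy => ?_)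
      (fun i => ?_) ?_
    · exact ((hv i).edist ((hv i).comp (hcontσ σ))).aemeasurable
    · exact (hlim y hy).edist (hlim _ (hmaps σ hσ y hy))
    · have hGm : Measurable fun z => g z + h i z := hg.add (hh i)
      calc ∫⁻ y in Q, edist (v i y) (v i (x + σ • (y - x)))
          ≤ ∫⁻ y in Q, ENNReal.ofReal (2 * ρ) *
            ∫⁻ s in Ioc σ 1, (g (x + s • (y - x)) + h i (x + s • (y - x))) := by
            refine setLIntegral_mono' hQm fun y hy => (hseg i x hx y hy σ hσ).trans ?_
            exact mul_le_mul_left (hdist y hy) _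
        _ = ENNReal.ofReal (2 * ρ) * ∫⁻ s in Ioc σ 1, ∫⁻ y in Q,
              (g (x + s • (y - x)) + h i (x + s • (y - x))) := by
            rw [lintegral_const_mul' _ _ ENNReal.ofReal_ne_top]
            congr 1
            refine lintegral_lintegral_swap (Measurable.aemeasurable ?_)
            exact (hGm.comp hcont2).comp measurable_swap
        _ ≤ _ := by
            refine mul_le_mul_right ?_ _
            have hadd : ∀ s : ℝ, ∫⁻ y in Q, (g (x + s • (y - x)) + h i (x + s • (y - x))) =
                (∫⁻ y in Q, g (x + s • (y - x))) + ∫⁻ y in Q, h i (x + s • (y - x)) := fun s =>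
              lintegral_add_left (hg.comp (hcontσ s).measurable) _
            simp only [hadd]
            rw [lintegral_add_left (hprod hg)]
            refine add_le_add (lintegral_mono_set (Ioc_subset_Ioc_left hσ.1.le)) ?_
            calc ∫⁻ s in Ioc σ 1, ∫⁻ y in Q, h i (x + s • (y - x))
                ≤ ∫⁻ s in Ioc σ 1, (ENNReal.ofReal (σ ^ k))⁻¹ * ∫⁻ z in Q, h i z := by
                  refine setLIntegral_mono' measurableSet_Ioc fun s hs => ?_
                  have hs0 : 0 < s := hσ.1.trans hs.1
                  refine (lintegral_homothety_le x hs0 hs.2 hQc hQm hx (hh i)).trans ?_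
                  gcongr
                  · exact hσ.1.le
                  · exact hs.1.le
              _ ≤ (ENNReal.ofReal (σ ^ k))⁻¹ * ∫⁻ z in Q, h i z := by
                  rw [setLIntegral_const, Real.volume_Ioc]
                  refine mul_le_of_le_one_right zero_le ?_
                  rw [ENNReal.ofReal_le_one]
                  linarith [hσ.1]
    · have : Filter.Tendsto (fun i => ENNReal.ofReal (2 * ρ) *
          ((∫⁻ s in Ioc (0 : ℝ) 1, ∫⁻ y in Q, g (x + s • (y - x))) +
            (ENNReal.ofReal (σ ^ k))⁻¹ * ∫⁻ z in Q, h i z)) Filter.atTop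
          (𝓝 (ENNReal.ofReal (2 * ρ) *
          ((∫⁻ s in Ioc (0 : ℝ) 1, ∫⁻ y in Q, g (x + s • (y - x))) +
            (ENNReal.ofReal (σ ^ k))⁻¹ * 0))) :=
        ENNReal.Tendsto.const_mul (tendsto_const_nhds.add
          (ENNReal.Tendsto.const_mul hh0 (Or.inr (ENNReal.inv_ne_top.2 hσk))))
          (Or.inr ENNReal.ofReal_ne_top)
      simpa using this
  have hσi : ∀ i : ℕ, 1 / ((i : ℝ) + 2) ∈ Ioo (0 : ℝ) 1 := fun i => by
    refine ⟨by positivity, ?_⟩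
    rw [div_lt_one (by positivity)]
    linarith [(Nat.cast_nonneg i : (0 : ℝ) ≤ i)]
  have hσlim : Filter.Tendsto (fun i : ℕ => 1 / ((i : ℝ) + 2)) Filter.atTop (𝓝 0) := by
    have := (tendsto_one_div_add_atTop_nhds_zero_nat (𝕜 := ℝ)).comp (Filter.tendsto_add_atTop_nat 1)
    refine this.congr fun i => ?_
    simp only [Function.comp]
    push_cast
    ring
  refine setLIntegral_le_of_tendsto hQm
    (f := fun i y => edist (u y) (u (x + (1 / ((i : ℝ) + 2)) • (y - x))))
    (fun i => ?_) (fun y hy => ?_) (fun i => step1 _ (hσi i)) tendsto_const_nhds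
  · refine ContinuousOn.aemeasurable ?_ hQm
    exact continuous_edist.comp_continuousOn
      (hu.prodMk (hu.comp (hcontσ _).continuousOn fun y hy => hmaps _ (hσi i) y hy))
  · refine tendsto_const_nhds.edist ?_
    refine (hu x hx).tendsto.comp (tendsto_nhdsWithin_iff.2
      ⟨?_, Filter.Eventually.of_forall fun i => hmaps _ (hσi i) y hy⟩)
    have : Filter.Tendsto (fun i : ℕ => x + (1 / ((i : ℝ) + 2)) • (y - x)) Filter.atTop
        (𝓝 (x + (0 : ℝ) • (y - x))) := tendsto_const_nhds.add (hσlim.smul_const _)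
    simpa using this

section Mollifier

variable {G E : Type*} [NormedAddCommGroup G] [NormedSpace ℝ G] [FiniteDimensional ℝ G]
  [MeasurableSpace G] [BorelSpace G] {μ : Measure G} [μ.IsAddHaarMeasure]
  [NormedAddCommGroup E]

theorem tendsto_lintegral_enorm_translate_sub {g : G → E} (hg : Integrable g μ) :
    Filter.Tendsto (fun t => ∫⁻ x, ‖g (x - t) - g x‖ₑ ∂μ) (𝓝 0) (𝓝 0) := by
  have hL : MemLp g 1 μ := memLp_one_iff_integrable.2 hg
  have : Fact ((1 : ℝ≥0∞) ≠ ∞) := ⟨one_ne_top⟩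
  have hc : Continuous fun t : G => (DomAddAct.mk (-t)) +ᵥ hL.toLp g :=
    (DomAddAct.continuous_mk.comp continuous_neg).vadd continuous_const
  have h0 := hc.tendsto 0
  rw [tendsto_iff_edist_tendsto_0] at h0
  refine h0.congr fun t => ?_
  rw [neg_zero, DomAddAct.mk_vadd_toLp, DomAddAct.mk_vadd_toLp, Lp.edist_toLp_toLp,
    eLpNorm_one_eq_lintegral_enorm]
  refine lintegral_congr fun x => ?_
  simp [sub_eq_neg_add]

variable [NormedSpace ℝ E] [CompleteSpace E]

theorem tendsto_lintegral_enorm_normed_convolution_sub {g : G → E} (hg : Integrable g μ)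
    {η : ℕ → ContDiffBump (0 : G)}
    (hη : Filter.Tendsto (fun i => (η i).rOut) Filter.atTop (𝓝 0)) :
    Filter.Tendsto (fun i => ∫⁻ x, ‖((η i).normed μ ⋆[ContinuousLinearMap.lsmul ℝ ℝ, μ] g) x - g x‖ₑ
      ∂μ) Filter.atTop (𝓝 0) := by
  wlog hgs : StronglyMeasurable g generalizing g
  · have h := this (g := hg.1.mk g) (hg.congr hg.1.ae_eq_mk) hg.1.stronglyMeasurable_mk
    refine h.congr fun i => lintegral_congr_ae ?_
    filter_upwards [hg.1.ae_eq_mk] with x hx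
    rw [convolution_congr _ (Filter.EventuallyEq.refl _ ((η i).normed μ)) hg.1.ae_eq_mk, hx]
  rw [ENNReal.tendsto_nhds_zero]
  intro ε hε
  obtain ⟨δ, hδ, hD⟩ := Metric.eventually_nhds_iff.1
    ((ENNReal.tendsto_nhds_zero.1 (tendsto_lintegral_enorm_translate_sub hg)) ε hε)
  filter_upwards [hη.eventually (gt_mem_nhds hδ)] with i hi
  have hηm : Measurable fun t => ENNReal.ofReal ((η i).normed μ t) :=
    (η i).continuous_normed.measurable.ennreal_ofReal
  have hmeas : Measurable (Function.uncurry fun x t : G =>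
      ENNReal.ofReal ((η i).normed μ t) * ‖g (x - t) - g x‖ₑ) := by
    refine (hηm.comp measurable_snd).mul ?_
    exact ((hgs.comp_measurable (measurable_fst.sub measurable_snd)).sub
      (hgs.comp_measurable measurable_fst)).enorm
  calc ∫⁻ x, ‖((η i).normed μ ⋆[ContinuousLinearMap.lsmul ℝ ℝ, μ] g) x - g x‖ₑ ∂μ
      ≤ ∫⁻ x, ∫⁻ t, ENNReal.ofReal ((η i).normed μ t) * ‖g (x - t) - g x‖ₑ ∂μ ∂μ := by
        refine lintegral_mono_ae ?_
        filter_upwards [Integrable.ae_convolution_exists (ContinuousLinearMap.lsmul ℝ ℝ)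
          ((η i).integrable_normed (μ := μ)) hg] with x hx
        have e : ((η i).normed μ ⋆[ContinuousLinearMap.lsmul ℝ ℝ, μ] g) x - g x
            = ∫ t, (η i).normed μ t • (g (x - t) - g x) ∂μ := by
          simp_rw [smul_sub]
          have hx' : Integrable (fun t => (η i).normed μ t • g (x - t)) μ := hx
          rw [integral_sub hx' ((η i).integrable_normed.smul_const (g x)),
            (η i).integral_normed_smul μ (g x)]
          rfl
        rw [e]
        refine (enorm_integral_le_lintegral_enorm _).trans (le_of_eq (lintegral_congr fun t => ?_))
        rw [enorm_smul, Real.enorm_of_nonneg ((η i).nonneg_normed t)]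
    _ = ∫⁻ t, ENNReal.ofReal ((η i).normed μ t) * ∫⁻ x, ‖g (x - t) - g x‖ₑ ∂μ ∂μ := by
        rw [lintegral_lintegral_swap hmeas.aemeasurable]
        refine lintegral_congr fun t => ?_
        exact lintegral_const_mul _ ((hgs.comp_measurable (measurable_id.sub_const t)).sub hgs).enorm
    _ ≤ ∫⁻ t, ENNReal.ofReal ((η i).normed μ t) * ε ∂μ := by
        refine lintegral_mono fun t => ?_
        by_cases ht : t ∈ ball (0 : G) (η i).rOut
        · exact mul_le_mul' le_rfl (hD ((mem_ball.1 ht).trans hi))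
        · rw [← (η i).support_normed_eq (μ := μ), Function.notMem_support] at ht
          simp [ht]
    _ = ε := by
        rw [lintegral_mul_const _ hηm, ← ofReal_integral_eq_lintegral_ofReal
          (η i).integrable_normed (Filter.Eventually.of_forall (η i).nonneg_normed),
          (η i).integral_normed]
        simp

end Mollifier

theorem LocallyIntegrableOn.integrable_indicator_of_isCompact {G E : Type*} [TopologicalSpace G]
    [T2Space G] [MeasurableSpace G] [OpensMeasurableSpace G] [NormedAddCommGroup E] {μ : Measure G}
    {g : G → E} {U K : Set G} (hg : LocallyIntegrableOn g U μ) (hK : IsCompact K) (hKU : K ⊆ U) :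
    Integrable (K.indicator g) μ :=
  (hg.integrableOn_compact_subset hKU hK).integrable_indicator hK.measurableSet

theorem IsWeakFDerivOn.fderiv_convolution {n m : ℕ} {U : Set (Euc n)} {f : Euc n → Euc m}
    {Df : Euc n → (Euc n →L[ℝ] Euc m)} (hD : IsWeakFDerivOn U f Df) {K : Set (Euc n)}
    (hK : IsCompact K) (hKU : K ⊆ U) (η : ContDiffBump (0 : Euc n)) {x : Euc n}
    (hx : closedBall x η.rOut ⊆ K) :
    fderiv ℝ (η.normed volume ⋆[ContinuousLinearMap.lsmul ℝ ℝ, volume] K.indicator f) x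
      = (η.normed volume ⋆[ContinuousLinearMap.lsmul ℝ ℝ, volume] K.indicator Df) x := by
  have hfi : Integrable (K.indicator f) volume :=
    LocallyIntegrableOn.integrable_indicator_of_isCompact hD.1 hK hKU
  have hgi : Integrable (K.indicator Df) volume :=
    LocallyIntegrableOn.integrable_indicator_of_isCompact hD.2.1 hK hKU
  have hη1 : ContDiff ℝ 1 (η.normed (volume : Measure (Euc n))) := η.contDiff_normed (n := 1)
  have hηd : ∀ y, DifferentiableAt ℝ (η.normed (volume : Measure (Euc n))) y :=
    fun y => hη1.differentiable one_ne_zero y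
  have hηc : HasCompactSupport (η.normed (volume : Measure (Euc n))) := η.hasCompactSupport_normed
  rw [(hηc.hasFDerivAt_convolution_left (ContinuousLinearMap.lsmul ℝ ℝ) hη1
    hfi.locallyIntegrable x).fderiv]
  have hKs : ∀ t, t ∉ K → x - t ∉ tsupport (η.normed (volume : Measure (Euc n))) := by
    intro t ht h
    rw [η.tsupport_normed_eq, mem_closedBall, dist_zero_right] at h
    exact ht (hx (by rwa [mem_closedBall, dist_comm, dist_eq_norm]))
  have hη0 : ∀ t, t ∉ K → η.normed (volume : Measure (Euc n)) (x - t) = 0 :=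
    fun t ht => image_eq_zero_of_notMem_tsupport (hKs t ht)
  have hη0' : ∀ t, t ∉ K → fderiv ℝ (η.normed (volume : Measure (Euc n))) (x - t) = 0 :=
    fun t ht => image_eq_zero_of_notMem_tsupport fun h => hKs t ht (tsupport_fderiv_subset ℝ h)
  ext1 v
  have e1 : ((fderiv ℝ (η.normed volume) ⋆[(ContinuousLinearMap.lsmul ℝ ℝ).precompL (Euc n), volume]
      K.indicator f) x) v
      = ∫ t, (fderiv ℝ (η.normed volume) (x - t) v) • K.indicator f t := by
    have hex : ConvolutionExistsAt (fderiv ℝ (η.normed (volume : Measure (Euc n)))) (K.indicator f) x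
        ((ContinuousLinearMap.lsmul ℝ ℝ).precompL (Euc n)) volume :=
      (hηc.fderiv ℝ).convolutionExists_left _ (hη1.continuous_fderiv one_ne_zero)
        hfi.locallyIntegrable x
    rw [convolution_eq_swap, ContinuousLinearMap.integral_apply hex.integrable_swap]
    rfl
  have e2 : ((η.normed volume ⋆[ContinuousLinearMap.lsmul ℝ ℝ, volume] K.indicator Df) x) v
      = ∫ t, η.normed volume (x - t) • K.indicator Df t v := by
    have hex : ConvolutionExistsAt (η.normed (volume : Measure (Euc n))) (K.indicator Df) x
        (ContinuousLinearMap.lsmul ℝ ℝ) volume :=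
      hηc.convolutionExists_left _ hη1.continuous hgi.locallyIntegrable x
    rw [convolution_eq_swap, ContinuousLinearMap.integral_apply hex.integrable_swap]
    rfl
  rw [e1, e2]
  have hψ := hD.2.2 (fun t => η.normed volume (x - t))
    ((η.contDiff_normed (n := ⊤)).comp (contDiff_const.sub contDiff_id)) ?_ ?_ v
  · rw [setIntegral_eq_integral_of_forall_compl_eq_zero (fun t ht => by
        rw [hη0 t fun h => ht (hKU h), zero_smul])] at hψ
    have hfd : ∀ t, fderiv ℝ (fun t => η.normed (volume : Measure (Euc n)) (x - t)) t v
        = - fderiv ℝ (η.normed volume) (x - t) v := by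
      intro t
      have h1 : HasFDerivAt (fun t : Euc n => x - t) (-ContinuousLinearMap.id ℝ (Euc n)) t :=
        (hasFDerivAt_id t).const_sub x
      have := ((hηd (x - t)).hasFDerivAt.comp t h1).fderiv
      erw [this]
      simp
    simp_rw [hfd] at hψ
    rw [setIntegral_eq_integral_of_forall_compl_eq_zero (fun t ht => by
        rw [hη0' t fun h => ht (hKU h)]; simp)] at hψ
    simp_rw [neg_smul] at hψ
    rw [integral_neg, neg_neg] at hψ
    calc _ = ∫ t, (fderiv ℝ (η.normed volume) (x - t) v) • f t := by
          refine integral_congr_ae (Filter.Eventually.of_forall fun t => ?_)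
          by_cases ht : t ∈ K
          · simp [ht]
          · simp [ht, hη0' t ht]
      _ = _ := hψ.symm
      _ = _ := by
          refine integral_congr_ae (Filter.Eventually.of_forall fun t => ?_)
          by_cases ht : t ∈ K
          · simp [ht]
          · simp [ht, hη0 t ht]
  · exact HasCompactSupport.intro hK hη0
  · refine (closure_minimal (fun t ht => ?_) hK.isClosed).trans hKU
    exact by_contra fun h => Function.mem_support.1 ht (hη0 t h)

theorem IsWeakFDerivOn.exists_contDiff_tendsto {n m : ℕ} {U : Set (Euc n)} (hU : IsOpen U)
    {f : Euc n → Euc m} (hf : ContinuousOn f U)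
    {Df : Euc n → (Euc n →L[ℝ] Euc m)} (hD : IsWeakFDerivOn U f Df) {K : Set (Euc n)}
    (hK : IsCompact K) (hKU : K ⊆ U) :
    ∃ F : ℕ → Euc n → Euc m, (∀ i, ContDiff ℝ 1 (F i)) ∧
      (∀ x ∈ K, Filter.Tendsto (fun i => F i x) Filter.atTop (𝓝 (f x))) ∧
      Filter.Tendsto (fun i => ∫⁻ x in K, ‖fderiv ℝ (F i) x - Df x‖ₑ) Filter.atTop (𝓝 0) := by
  obtain ⟨δ, hδ, hδU⟩ := hK.exists_cthickening_subset_open hU hKU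
  have hK' : IsCompact (cthickening δ K) := hK.cthickening
  set K' := cthickening δ K with hK'def
  have hfi : Integrable (K'.indicator f) volume :=
    LocallyIntegrableOn.integrable_indicator_of_isCompact hD.1 hK' hδU
  have hgi : Integrable (K'.indicator Df) volume :=
    LocallyIntegrableOn.integrable_indicator_of_isCompact hD.2.1 hK' hδU
  have hpos : ∀ i : ℕ, 0 < δ / (i + 1) := fun i => by positivity
  let η : ℕ → ContDiffBump (0 : Euc n) := fun i => ⟨δ / (i + 1) / 2, δ / (i + 1),
    half_pos (hpos i), half_lt_self (hpos i)⟩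
  have hη : Filter.Tendsto (fun i => (η i).rOut) Filter.atTop (𝓝 0) := by
    have h := (tendsto_one_div_add_atTop_nhds_zero_nat (𝕜 := ℝ)).const_mul δ
    rw [mul_zero] at h
    exact h.congr fun i => mul_one_div _ _
  refine ⟨fun i => (η i).normed volume ⋆[ContinuousLinearMap.lsmul ℝ ℝ, volume] K'.indicator f,
    fun i => ?_, fun x hx => ?_, ?_⟩
  · exact (η i).hasCompactSupport_normed.contDiff_convolution_left _
      ((η i).contDiff_normed (n := 1)) hfi.locallyIntegrable
  · have hn : K' ∈ 𝓝 x := Filter.mem_of_superset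
      (isOpen_thickening.mem_nhds (self_subset_thickening hδ K hx))
      (thickening_subset_cthickening δ K)
    have hxK' : x ∈ K' := mem_of_mem_nhds hn
    have hct : Filter.Tendsto (K'.indicator f) (𝓝 x) (𝓝 (f x)) :=
      (hf.continuousAt (hU.mem_nhds (hKU hx))).tendsto.congr'
        (by filter_upwards [hn] with y hy using (indicator_of_mem hy f).symm)
    exact ContDiffBump.convolution_tendsto_right (g := fun _ => K'.indicator f) (k := fun _ => x) hη
      (Filter.Eventually.of_forall fun _ => hfi.1) (hct.comp Filter.tendsto_snd) tendsto_const_nhds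
  · refine tendsto_of_tendsto_of_tendsto_of_le_of_le tendsto_const_nhds
      (tendsto_lintegral_enorm_normed_convolution_sub hgi hη) (fun _ => zero_le) fun i => ?_
    refine le_trans (le_of_eq ?_) (setLIntegral_le_lintegral K _)
    refine setLIntegral_congr_fun hK.measurableSet fun x hx => ?_
    have hr : (η i).rOut ≤ δ := div_le_self hδ.le (by simp)
    have hball : closedBall x (η i).rOut ⊆ K' :=
      (closedBall_subset_closedBall hr).trans (closedBall_subset_cthickening hx δ)
    have hxK' : x ∈ K' := hball (mem_closedBall_self (η i).rOut_pos.le)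
    simp only []
    rw [hD.fderiv_convolution hK' hδU (η i) hball, indicator_of_mem hxK']

theorem opNorm_le_frobNorm {n m : ℕ} (A : Euc n →L[ℝ] Euc m) : ‖A‖ ≤ frobNorm A := by
  refine A.opNorm_le_bound (Real.sqrt_nonneg _) fun x => ?_
  have hx : x = ∑ j, x j • EuclideanSpace.single j (1 : ℝ) := by
    ext i
    simp [Finset.sum_apply, Pi.single_apply]
  have hA : ∀ i, A x i = ∑ j, x j * A (EuclideanSpace.single j (1 : ℝ)) i := by
    intro i
    conv_lhs => rw [hx, map_sum]
    simp
  rw [frobNorm, EuclideanSpace.norm_eq, EuclideanSpace.norm_eq, ← Real.sqrt_mul (by positivity)]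
  refine Real.sqrt_le_sqrt ?_
  rw [Finset.sum_mul]
  refine Finset.sum_le_sum fun i _ => ?_
  rw [Real.norm_eq_abs, sq_abs, hA, mul_comm]
  simpa using Finset.sum_mul_sq_le_sq_mul_sq Finset.univ (fun j => x j)
    (fun j => A (EuclideanSpace.single j (1 : ℝ)) i)

theorem continuous_frobNorm {n m : ℕ} :
    Continuous (frobNorm : (Euc n →L[ℝ] Euc m) → ℝ) := by
  refine Real.continuous_sqrt.comp (continuous_finsetSum _ fun i _ =>
    continuous_finsetSum _ fun j _ => Continuous.pow ?_ 2)
  have h : Continuous fun A : Euc n →L[ℝ] Euc m => A (EuclideanSpace.single j (1 : ℝ)) :=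
    continuous_id.clm_apply continuous_const
  exact (EuclideanSpace.proj i).continuous.comp h

theorem edist_comp_segment_le {E W F : Type*} [NormedAddCommGroup E] [NormedSpace ℝ E]
    [NormedAddCommGroup W] [NormedSpace ℝ W] [NormedAddCommGroup F] [NormedSpace ℝ F]
    [CompleteSpace F] {G : W → F} (hG : ContDiff ℝ 1 G) {P : E → W} (hP : ContDiff ℝ 1 P)
    {s : Set E} (hs : Convex ℝ s) {L : ℝ≥0∞} (hL : ∀ z ∈ s, ‖fderiv ℝ P z‖ₑ ≤ L)
    {x y : E} (hx : x ∈ s) (hy : y ∈ s) {σ : ℝ} (hσ : σ ∈ Ioo (0 : ℝ) 1) :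
    edist (G (P y)) (G (P (x + σ • (y - x)))) ≤
      edist y x * ∫⁻ t in Ioc σ 1, L * ‖fderiv ℝ G (P (x + t • (y - x)))‖ₑ := by
  set γ : ℝ → E := fun t => x + t • (y - x) with hγ
  have hγd : ∀ t, HasDerivAt γ (y - x) t := fun t => by
    have h := ((hasDerivAt_id t).smul_const (y - x)).const_add x
    rwa [one_smul] at h
  have hγc : Continuous γ := continuous_iff_continuousAt.2 fun t => (hγd t).continuousAt
  have hd : ∀ t, HasDerivAt (fun t => G (P (γ t)))
      (fderiv ℝ G (P (γ t)) (fderiv ℝ P (γ t) (y - x))) t := fun t =>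
    ((hG.differentiable one_ne_zero _).hasFDerivAt.comp_hasDerivAt t
      ((hP.differentiable one_ne_zero _).hasFDerivAt.comp_hasDerivAt t (hγd t)))
  have hcG : Continuous fun t => fderiv ℝ G (P (γ t)) :=
    (hG.continuous_fderiv one_ne_zero).comp (hP.continuous.comp hγc)
  have hcP : Continuous fun t => fderiv ℝ P (γ t) :=
    (hP.continuous_fderiv one_ne_zero).comp hγc
  have hcd : Continuous fun t => fderiv ℝ G (P (γ t)) (fderiv ℝ P (γ t) (y - x)) :=
    hcG.clm_apply (hcP.clm_apply continuous_const)
  have hint := intervalIntegral.integral_eq_sub_of_hasDerivAt (fun t _ => hd t)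
    (hcd.intervalIntegrable σ 1)
  have h1 : γ 1 = y := by simp [hγ]
  rw [h1, intervalIntegral.integral_of_le hσ.2.le] at hint
  rw [edist_eq_enorm_sub, ← hint, ← lintegral_const_mul' _ _ (edist_ne_top y x)]
  refine (enorm_integral_le_lintegral_enorm _).trans
    (setLIntegral_mono' measurableSet_Ioc fun t ht => ?_)
  have hmem : γ t ∈ s := hs.add_smul_sub_mem hx hy ⟨hσ.1.le.trans ht.1.le, ht.2⟩
  calc _ ≤ ‖fderiv ℝ G (P (γ t))‖ₑ * ‖fderiv ℝ P (γ t) (y - x)‖ₑ :=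
        ContinuousLinearMap.le_opENorm _ _
    _ ≤ ‖fderiv ℝ G (P (γ t))‖ₑ * (L * ‖y - x‖ₑ) := by
        gcongr
        exact (ContinuousLinearMap.le_opENorm _ _).trans
          (mul_le_mul' (hL _ hmem) le_rfl)
    _ = _ := by rw [edist_eq_enorm_sub]; ring

theorem enorm_le_enorm_add_enorm_sub {E : Type*} [NormedAddCommGroup E] (a b : E) :
    ‖b‖ₑ ≤ ‖a‖ₑ + ‖b - a‖ₑ := by
  simpa using enorm_add_le a (b - a)

theorem exists_subseq_ae_tendsto_zero {α : Type*} [MeasurableSpace α] {μ : Measure α}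
    {A : ℕ → α → ℝ≥0∞} (hA : ∀ i, Measurable (A i))
    (h : Filter.Tendsto (fun i => ∫⁻ r, A i r ∂μ) Filter.atTop (𝓝 0)) :
    ∃ ns : ℕ → ℕ, StrictMono ns ∧
      ∀ᵐ r ∂μ, Filter.Tendsto (fun i => A (ns i) r) Filter.atTop (𝓝 0) := by
  obtain ⟨ns, hns, hb⟩ := Filter.extraction_forall_of_eventually
    (P := fun i N => ∫⁻ r, A N r ∂μ ≤ (2⁻¹ : ℝ≥0∞) ^ i) fun i =>
      (ENNReal.tendsto_nhds_zero.1 h _ (ENNReal.pow_pos (by simp) i))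
  refine ⟨ns, hns, ?_⟩
  have hsum : ∫⁻ r, ∑' i, A (ns i) r ∂μ ≠ ∞ := by
    rw [lintegral_tsum fun i => (hA _).aemeasurable]
    refine ne_top_of_le_ne_top ?_ (ENNReal.tsum_le_tsum hb)
    rw [ENNReal.tsum_geometric]
    simp
  filter_upwards [ae_lt_top (Measurable.tsum fun i => hA _) hsum] with r hr
  exact ENNReal.tendsto_atTop_zero_of_tsum_ne_top hr.ne

theorem edist_pow_le_of_approx {k : ℕ} (hk : 2 ≤ k) {n m : ℕ} {f : Euc n → Euc m}
    {Df : Euc n → (Euc n →L[ℝ] Euc m)} (hDm : Measurable Df)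
    {F : ℕ → Euc n → Euc m} (hF : ∀ i, ContDiff ℝ 1 (F i))
    {P : (Fin k → ℝ) → Euc n} (hP : ContDiff ℝ 1 P) {L : ℝ≥0∞}
    {w : ℕ → ℝ≥0∞} (hw0 : ∀ j, w j ≠ 0) (hwt : ∀ j, w j ≠ ∞)
    {c : Fin k → ℝ} {ρ : ℝ} (hρ : 0 < ρ) (hu : ContinuousOn (fun z => f (P z)) (closedBall c ρ))
    (hL : ∀ z ∈ closedBall c ρ, ‖fderiv ℝ P z‖ₑ ≤ L) (hLt : L ≠ ∞)
    (hlim : ∀ z ∈ closedBall c ρ, Filter.Tendsto (fun i => F i (P z)) Filter.atTop (𝓝 (f (P z))))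
    (hlim1 : Filter.Tendsto (fun i => ∫⁻ z in closedBall c ρ, ‖fderiv ℝ (F i) (P z) - Df (P z)‖ₑ)
      Filter.atTop (𝓝 0)) {x x' : Fin k → ℝ} (hx : x ∈ closedBall c ρ) (hx' : x' ∈ closedBall c ρ) :
    edist (f (P x)) (f (P x')) ^ k ≤ (4 * L) ^ k * (∑' j, calderonCoeff k w j) ^ (k - 1) *
      ∫⁻ z in closedBall c ρ, levelWeight w (frobNorm (Df (P z))) := by
  have hDP : Measurable fun z => Df (P z) := hDm.comp hP.continuous.measurable
  have hp : Measurable fun z => frobNorm (Df (P z)) := continuous_frobNorm.measurable.comp hDP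
  refine edist_pow_le_of_lintegral_segment_le hk (u := fun z => f (P z)) hp hw0 hwt hρ hu ?_ hx hx'
  intro x hx
  have hFd : ∀ i, Measurable fun z => ‖fderiv ℝ (F i) (P z) - Df (P z)‖ₑ := fun i =>
    (((((hF i).continuous_fderiv one_ne_zero).comp hP.continuous).measurable).sub hDP).enorm
  refine lintegral_edist_le_of_approx hu (v := fun i z => F i (P z))
    (fun i => (hF i).continuous.comp hP.continuous) hlim
    (g := fun z => L * ENNReal.ofReal (frobNorm (Df (P z)))) (hp.ennreal_ofReal.const_mul L)
    (h := fun i z => L * ‖fderiv ℝ (F i) (P z) - Df (P z)‖ₑ) (fun i => (hFd i).const_mul L) ?_ ?_ hx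
  · have h := ENNReal.Tendsto.const_mul hlim1 (Or.inr hLt)
    rw [mul_zero] at h
    exact h.congr fun i => (lintegral_const_mul _ (hFd i)).symm
  · intro i x hx y hy σ hσ
    refine (edist_comp_segment_le (hF i) hP (convex_closedBall c ρ) hL hx hy hσ).trans ?_
    gcongr with s
    rw [← mul_add]
    gcongr
    set z := P (x + s • (y - x))
    refine (enorm_le_enorm_add_enorm_sub (Df z) _).trans (add_le_add_left ?_ _)
    rw [← ofReal_norm]
    exact ENNReal.ofReal_le_ofReal (opNorm_le_frobNorm _)

theorem measurable_levelWeight_comp_frobNorm {α : Type*} [MeasurableSpace α] {n m : ℕ}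
    {A : α → (Euc n →L[ℝ] Euc m)} (hA : Measurable A) (w : ℕ → ℝ≥0∞) :
    Measurable fun x => levelWeight w (frobNorm (A x)) :=
  (measurable_levelWeight w).comp (continuous_frobNorm.measurable.comp hA)

theorem ae_exists_measure_image_le {n m k : ℕ} (hk : 2 ≤ k) {U : Set (Euc n)} (hU : IsOpen U)
    {φ : ℝ → ℝ} (hφ : MonotoneOn φ (Ici 0))
    (hS : ∑' j, calderonCoeff k (dyadicWeight φ) j ≠ ∞)
    {f : Euc n → Euc m} (hf : ContinuousOn f U) {Df : Euc n → (Euc n →L[ℝ] Euc m)}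
    (hD : MemOrliczSobolevWith φ U f Df) {K : Set (Euc n)} (hK : IsCompact K) (hKU : K ⊆ U)
    {Ψ : (Fin k → ℝ) × ℝ → Euc n} (hΨ : ContDiff ℝ 1 Ψ) {I : Set ℝ} (hI : MeasurableSet I) {R : ℝ}
    (hΨK : ∀ z ∈ closedBall 0 R, ∀ r ∈ I, Ψ (z, r) ∈ K) {L : ℝ≥0∞} (hLt : L ≠ ∞)
    (hL : ∀ z ∈ closedBall 0 R, ∀ r ∈ I, ‖fderiv ℝ (fun z => Ψ (z, r)) z‖ₑ ≤ L)
    {C : ℝ≥0∞} (hC : C ≠ ∞)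
    (hΨm : ∀ h : Euc n → ℝ≥0∞, Measurable h →
      ∫⁻ r in I, ∫⁻ z in closedBall 0 R, h (Ψ (z, r)) ≤ C * ∫⁻ x in K, h x) :
    ∀ᵐ r : ℝ, r ∈ I → ∃ ν : Measure (Fin k → ℝ), IsFiniteMeasure ν ∧ ν ≪ volume ∧
      (∀ B ⊆ ball 0 R, μH[(k : ℝ)] ((fun z => f (Ψ (z, r))) '' B) ≤ ν B) ∧
      ∀ B ⊆ ball 0 R, (∀ z ∈ B, frobNorm (Df (Ψ (z, r))) = 0) → ν B = 0 := by
  set w := dyadicWeight φ with hw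
  have hwt : ∀ j, w j ≠ ∞ := fun j => dyadicWeight_ne_top φ j
  have hw0 : ∀ j, w j ≠ 0 := dyadicWeight_ne_zero hk hS
  have hDi : AEStronglyMeasurable Df (volume.restrict K) :=
    (hD.1.2.1.integrableOn_compact_subset hKU hK).1
  obtain ⟨D', hD's, hD'⟩ := hDi
  have hD'm : Measurable D' := hD's.measurable
  obtain ⟨F, hF, hFlim, hF1⟩ := hD.1.exists_contDiff_tendsto hU hf hK hKU
  have hΨmeas : Measurable Ψ := hΨ.continuous.measurable
  have slice_meas : ∀ h : Euc n → ℝ≥0∞, Measurable h →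
      Measurable fun r => ∫⁻ z in closedBall (0 : Fin k → ℝ) R, h (Ψ (z, r)) := fun h hh =>
    Measurable.lintegral_prod_left' (hh.comp hΨmeas)
  have slice_ae : ∀ᵐ r ∂volume.restrict I, ∀ᵐ z ∂volume.restrict (closedBall (0 : Fin k → ℝ) R),
      Df (Ψ (z, r)) = D' (Ψ (z, r)) := by
    set N := toMeasurable (volume.restrict K) {x | ¬ Df x = D' x} with hN
    have hNm : MeasurableSet N := measurableSet_toMeasurable _ _
    have hN0 : (volume.restrict K) N = 0 := by rw [hN, measure_toMeasurable]; exact ae_iff.1 hD'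
    have hind : Measurable (N.indicator (1 : Euc n → ℝ≥0∞)) := measurable_one.indicator hNm
    have h0 := hΨm _ hind
    rw [lintegral_indicator_one hNm, hN0, mul_zero, nonpos_iff_eq_zero,
      lintegral_eq_zero_iff (slice_meas _ hind)] at h0
    filter_upwards [h0] with r hr
    have hr' := (lintegral_eq_zero_iff (hind.comp (hΨmeas.comp measurable_prodMk_right))).1 hr
    filter_upwards [hr'] with z hz
    by_contra hne
    have : Ψ (z, r) ∈ N := subset_toMeasurable _ _ hne
    simp [this] at hz
  have hF1' : Filter.Tendsto (fun i => ∫⁻ x in K, ‖fderiv ℝ (F i) x - D' x‖ₑ) Filter.atTop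
      (𝓝 0) := by
    refine hF1.congr fun i => lintegral_congr_ae ?_
    filter_upwards [hD'] with x hx
    rw [hx]
  have hFm : ∀ i, Measurable fun x => ‖fderiv ℝ (F i) x - D' x‖ₑ := fun i =>
    (((hF i).continuous_fderiv one_ne_zero).measurable.sub hD'm).enorm
  obtain ⟨ns, hns, hns1⟩ := exists_subseq_ae_tendsto_zero (μ := volume.restrict I)
    (fun i => slice_meas _ (hFm i)) (tendsto_of_tendsto_of_tendsto_of_le_of_le tendsto_const_nhds
      (by simpa using ENNReal.Tendsto.const_mul hF1' (Or.inr hC)) (fun _ => zero_le)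
      (fun i => hΨm _ (hFm i)))
  have hwm : Measurable fun x => levelWeight w (frobNorm (D' x)) :=
    measurable_levelWeight_comp_frobNorm hD'm w
  have hfin : ∫⁻ x in K, levelWeight w (frobNorm (D' x)) < ∞ := by
    calc _ = ∫⁻ x in K, levelWeight w (frobNorm (Df x)) := lintegral_congr_ae (by
            filter_upwards [hD'] with x hx
            rw [hx])
      _ ≤ ∫⁻ x in K, (1 + ENNReal.ofReal (φ (frobNorm (Df x)))) :=
          lintegral_mono fun x => levelWeight_dyadicWeight_le hφ _
      _ = volume K + ∫⁻ x in K, ENNReal.ofReal (φ (frobNorm (Df x))) := by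
          rw [lintegral_add_left measurable_const]
          simp
      _ < ∞ := ENNReal.add_lt_top.2 ⟨hK.measure_lt_top, hD.2 K hKU hK⟩
  have hfin_ae := ae_lt_top (slice_meas _ hwm)
    ((hΨm _ hwm).trans_lt (ENNReal.mul_lt_top hC.lt_top hfin)).ne
  rw [← ae_restrict_iff' hI]
  filter_upwards [slice_ae, hns1, hfin_ae, ae_restrict_mem hI] with r hr1 hr2 hr3 hrI
  have hP : ContDiff ℝ 1 fun z => Ψ (z, r) := hΨ.comp (contDiff_id.prodMk contDiff_const)
  set wp : (Fin k → ℝ) → ℝ≥0∞ := fun z => levelWeight w (frobNorm (D' (Ψ (z, r)))) with hwp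
  have hwpm : Measurable wp := hwm.comp hP.continuous.measurable
  set μ := volume.restrict (closedBall (0 : Fin k → ℝ) R)
  set ν₀ := μ.withDensity wp with hν₀
  have hν₀f : IsFiniteMeasure ν₀ := isFiniteMeasure_withDensity hr3.ne
  have hν₀ac : ν₀ ≪ volume :=
    (withDensity_absolutelyContinuous μ wp).trans Measure.restrict_le_self.absolutelyContinuous
  set C' : ℝ≥0∞ := (4 * L) ^ k * (∑' j, calderonCoeff k w j) ^ (k - 1) with hC'def
  have hC' : C' ≠ ∞ := ENNReal.mul_ne_top (ENNReal.pow_ne_top (ENNReal.mul_ne_top (by simp) hLt))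
    (ENNReal.pow_ne_top hS)
  have hu : ContinuousOn (fun z => f (Ψ (z, r))) (closedBall 0 R) :=
    hf.comp hP.continuous.continuousOn fun z hz => hKU (hΨK z hz r hrI)
  refine ⟨C' • ν₀, ?_, ?_, ?_, ?_⟩
  · exact ⟨ENNReal.mul_lt_top hC'.lt_top (measure_lt_top ν₀ univ)⟩
  · exact hν₀ac.smul_left C'
  · intro B hB
    refine hausdorffMeasure_image_le_of_edist_pow_le (by omega) isOpen_ball
      (hu.mono ball_subset_closedBall) ν₀ hC' ?_ hB
    intro c ρ hρ hsub x hx x' hx'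
    have hsub' : closedBall c ρ ⊆ closedBall 0 R := hsub.trans ball_subset_closedBall
    have key := edist_pow_le_of_approx hk hD'm (fun i => hF (ns i)) hP hw0 hwt hρ
      (hu.mono hsub') (fun z hz => hL z (hsub' hz) r hrI) hLt
      (fun z hz => (hFlim _ (hΨK z (hsub' hz) r hrI)).comp hns.tendsto_atTop)
      (tendsto_of_tendsto_of_tendsto_of_le_of_le tendsto_const_nhds hr2 (fun _ => zero_le)
        fun i => lintegral_mono_set hsub') hx hx'
    refine key.trans (mul_le_mul' le_rfl (le_of_eq ?_))
    rw [hν₀, withDensity_apply _ measurableSet_closedBall,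
      Measure.restrict_restrict measurableSet_closedBall, inter_eq_self_of_subset_left hsub']
  · intro B hB hB0
    have h1 : ν₀ {z | wp z = 0} = 0 := by
      have hm : MeasurableSet {z | wp z = 0} := hwpm (measurableSet_singleton 0)
      rw [hν₀, withDensity_apply _ hm, setLIntegral_congr_fun hm (g := fun _ => 0) fun z hz => hz]
      simp
    have h2 : ν₀ {z | ¬ Df (Ψ (z, r)) = D' (Ψ (z, r))} = 0 :=
      withDensity_absolutelyContinuous μ wp (ae_iff.1 hr1)
    have h3 : ν₀ B = 0 := by
      refine measure_mono_null (fun z hz => ?_) (measure_union_null h1 h2)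
      by_cases hz' : Df (Ψ (z, r)) = D' (Ψ (z, r))
      · left
        change levelWeight w (frobNorm (D' (Ψ (z, r)))) = 0
        rw [← hz', hB0 z hz]
        exact levelWeight_of_nonpos _ le_rfl
      · exact Or.inr hz'
    rw [Measure.smul_apply, h3, smul_zero]

theorem exists_measure_image_le_of_lipschitzOnWith {E F : Type*}
    [NormedAddCommGroup E] [NormedSpace ℝ E] [FiniteDimensional ℝ E] [MeasurableSpace E]
    [BorelSpace E] [NormedAddCommGroup F] [NormedSpace ℝ F] [FiniteDimensional ℝ F]
    [MeasurableSpace F] [BorelSpace F] (hd : Module.finrank ℝ E = Module.finrank ℝ F)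
    (μ : Measure E) [μ.IsAddHaarMeasure] (ν : Measure F) [ν.IsAddHaarMeasure] (Λ : NNReal) :
    ∃ C : ℝ≥0∞, C ≠ ∞ ∧ ∀ (f : E → F) (s : Set E), LipschitzOnWith Λ f s → ν (f '' s) ≤ C * μ s := by
  set d := Module.finrank ℝ F with hdef
  have : (μH[d] : Measure E).IsAddHaarMeasure := by rw [← hd]; infer_instance
  have : (μH[d] : Measure F).IsAddHaarMeasure := by rw [hdef]; infer_instance
  have h1 := Measure.isAddLeftInvariant_eq_smul ν (μH[d] : Measure F)
  have h2 := Measure.isAddLeftInvariant_eq_smul (μH[d] : Measure E) μ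
  set c1 := Measure.addHaarScalarFactor ν (μH[d] : Measure F)
  set c2 := Measure.addHaarScalarFactor (μH[d] : Measure E) μ
  refine ⟨c1 * ((Λ : ℝ≥0∞) ^ (d : ℝ) * c2), by finiteness, fun f s hf => ?_⟩
  calc ν (f '' s) = c1 * μH[d] (f '' s) := by
        conv_lhs => rw [h1]
        rfl
    _ ≤ c1 * ((Λ : ℝ≥0∞) ^ (d : ℝ) * μH[d] s) := by
        gcongr
        exact hf.hausdorffMeasure_image_le (Nat.cast_nonneg d)
    _ = _ := by
        conv_lhs => rw [h2]
        rw [Measure.smul_apply, ENNReal.smul_def, smul_eq_mul]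
        ring

theorem exists_polar_parametrization {k : ℕ} {x₀ p : Euc (k + 1)} (hp : p ≠ x₀) :
    ∃ (Ψ : (Fin k → ℝ) × ℝ → Euc (k + 1)) (θ : Euc (k + 1) → (Fin k → ℝ)),
      ContDiff ℝ 1 Ψ ∧ ContDiffAt ℝ 1 θ p ∧
      (∀ z r, 0 < r → θ (Ψ (z, r)) = z ∧ ‖Ψ (z, r) - x₀‖ = r) ∧
      θ p = 0 ∧ ∀ᶠ x in 𝓝 p, Ψ (θ x, ‖x - x₀‖) = x := by
  have hp0 : p - x₀ ≠ 0 := sub_ne_zero.2 hp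
  have hn0 : 0 < ‖p - x₀‖ := norm_pos_iff.2 hp0
  set v : Euc (k + 1) := ‖p - x₀‖⁻¹ • (p - x₀) with hv
  have hv1 : ‖v‖ = 1 := by rw [hv, norm_smul, norm_inv, norm_norm, inv_mul_cancel₀ hn0.ne']
  obtain ⟨b, hb⟩ : ∃ b : OrthonormalBasis (Fin (k + 1)) ℝ (Euc (k + 1)), b 0 = v := by
    have ho : Orthonormal ℝ (({0} : Set (Fin (k + 1))).domRestrict fun _ => v) :=
      ⟨fun _ => hv1, fun i j hij => absurd (Subsingleton.elim i j) hij⟩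
    obtain ⟨b, hb⟩ := ho.exists_orthonormalBasis_extension_of_card_eq (by simp)
    exact ⟨b, hb 0 rfl⟩
  let N : (Fin k → ℝ) → Euc (k + 1) := fun z => ∑ i, (Fin.cons 1 z : Fin (k + 1) → ℝ) i • b i
  have hNi : ∀ z i, inner ℝ (b i) (N z) = (Fin.cons 1 z : Fin (k + 1) → ℝ) i := fun z i =>
    b.orthonormal.inner_right_fintype _ i
  have hN0 : ∀ z, N z ≠ 0 := by
    intro z h
    have := hNi z 0
    rw [h, inner_zero_right] at this
    simp at this
  have hNpos : ∀ z, 0 < ‖N z‖ := fun z => norm_pos_iff.2 (hN0 z)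
  have hNc : ContDiff ℝ 1 N := by
    have : N = fun z => b 0 + ∑ i : Fin k, z i • b i.succ := by
      funext z
      simp only [N, Fin.sum_univ_succ, Fin.cons_zero, one_smul, Fin.cons_succ]
    rw [this]
    exact contDiff_const.add (ContDiff.sum fun i _ => (contDiff_apply ℝ ℝ i).smul contDiff_const)
  refine ⟨fun q => x₀ + (q.2 / ‖N q.1‖) • N q.1,
    fun x i => inner ℝ (b i.succ) (x - x₀) / inner ℝ (b 0) (x - x₀), ?_, ?_, ?_, ?_, ?_⟩
  · have h1 : ContDiff ℝ 1 fun q : (Fin k → ℝ) × ℝ => N q.1 := hNc.comp contDiff_fst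
    exact contDiff_const.add
      ((contDiff_snd.div (h1.norm ℝ fun q => hN0 q.1) fun q => (hNpos q.1).ne').smul h1)
  · refine contDiffAt_pi.2 fun i => ?_
    have hs : ContDiffAt ℝ 1 (fun x : Euc (k + 1) => x - x₀) p := contDiffAt_id.sub contDiffAt_const
    refine (contDiffAt_const.inner ℝ hs).div (contDiffAt_const.inner ℝ hs) ?_
    rw [hb, hv, real_inner_smul_left, real_inner_self_eq_norm_sq]
    positivity
  · intro z r hr
    have hc : 0 < r / ‖N z‖ := div_pos hr (hNpos z)
    constructor
    · funext i
      have hne := (hNpos z).ne'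
      simp only [add_sub_cancel_left, inner_smul_right, hNi, Fin.cons_zero, Fin.cons_succ]
      field_simp
    · rw [add_sub_cancel_left, norm_smul, Real.norm_of_nonneg hc.le,
        div_mul_cancel₀ _ (hNpos z).ne']
  · funext i
    have : inner ℝ (b i.succ) (p - x₀) = (0 : ℝ) := by
      have h : p - x₀ = ‖p - x₀‖ • b 0 := by
        rw [hb, hv, smul_smul, mul_inv_cancel₀ hn0.ne', one_smul]
      rw [h, inner_smul_right, b.inner_eq_zero (Fin.succ_ne_zero i), mul_zero]
    simp [this]
  · have hcont : ContinuousAt (fun x : Euc (k + 1) => inner ℝ (b 0) (x - x₀)) p := by fun_prop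
    have hpos : 0 < inner ℝ (b 0) (p - x₀) := by
      rw [hb, hv, real_inner_smul_left, real_inner_self_eq_norm_sq]
      positivity
    filter_upwards [hcont.eventually (lt_mem_nhds hpos)] with x hx
    set a := inner ℝ (b 0) (x - x₀) with ha
    have hNx : N (fun i => inner ℝ (b i.succ) (x - x₀) / a) = a⁻¹ • (x - x₀) := by
      conv_rhs => rw [← b.sum_repr' (x - x₀), Finset.smul_sum]
      refine Finset.sum_congr rfl fun i _ => ?_
      rw [smul_smul]
      congr 1
      refine Fin.cases ?_ (fun j => ?_) i
      · rw [Fin.cons_zero, ← ha, inv_mul_cancel₀ hx.ne']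
      · rw [Fin.cons_succ, div_eq_inv_mul]
    have hx0 : 0 < ‖x - x₀‖ := norm_pos_iff.2 fun h => by simp [ha, h] at hx
    simp only [hNx, norm_smul, norm_inv, Real.norm_of_nonneg hx.le, smul_smul]
    have : ‖x - x₀‖ / (a⁻¹ * ‖x - x₀‖) * a⁻¹ = 1 := by field_simp
    rw [this, one_smul, add_sub_cancel]

/-- Away from `x₀`, polar coordinates give a chart in which the spheres around `x₀` become parallel
hyperplanes and integrals change by a bounded factor. -/
theorem exists_polar_chart {k : ℕ} {U : Set (Euc (k + 1))} (hU : IsOpen U) {x₀ p : Euc (k + 1)}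
    (hpU : p ∈ U) (hp : p ≠ x₀) :
    ∃ (K : Set (Euc (k + 1))) (Ψ : (Fin k → ℝ) × ℝ → Euc (k + 1)) (I : Set ℝ) (R : ℝ)
      (L C : ℝ≥0∞) (V : Set (Euc (k + 1))) (θ : Euc (k + 1) → (Fin k → ℝ)) (Λ : NNReal),
      IsCompact K ∧ K ⊆ U ∧ ContDiff ℝ 1 Ψ ∧ MeasurableSet I ∧
      (∀ z ∈ closedBall 0 R, ∀ r ∈ I, Ψ (z, r) ∈ K) ∧ L ≠ ∞ ∧
      (∀ z ∈ closedBall 0 R, ∀ r ∈ I, ‖fderiv ℝ (fun z => Ψ (z, r)) z‖ₑ ≤ L) ∧ C ≠ ∞ ∧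
      (∀ h : Euc (k + 1) → ℝ≥0∞, Measurable h →
        ∫⁻ r in I, ∫⁻ z in closedBall 0 R, h (Ψ (z, r)) ≤ C * ∫⁻ x in K, h x) ∧
      IsOpen V ∧ p ∈ V ∧ LipschitzOnWith Λ θ V ∧
      ∀ x ∈ V, θ x ∈ ball 0 R ∧ ‖x - x₀‖ ∈ I ∧ Ψ (θ x, ‖x - x₀‖) = x := by
  obtain ⟨Ψ, θ, hΨ, hθ, hinv, hθp, hloc⟩ := exists_polar_parametrization hp
  have hρ : 0 < ‖p - x₀‖ := norm_pos_iff.2 (sub_ne_zero.2 hp)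
  set ρ := ‖p - x₀‖ with hρdef
  let Θ : Euc (k + 1) → (Fin k → ℝ) × ℝ := fun x => (θ x, ‖x - x₀‖)
  have hΘ : ContDiffAt ℝ 1 Θ p :=
    hθ.prodMk ((contDiffAt_id.sub contDiffAt_const).norm ℝ (sub_ne_zero.2 hp))
  have hΘp : Θ p = (0, ρ) := by simp only [Θ, hθp, hρdef]
  have hΨp : Ψ (0, ρ) = p := hΘp ▸ hloc.self_of_nhds
  obtain ⟨Λ, T, hT, hLip⟩ := hΘ.exists_lipschitzOnWith
  have hpre : Ψ ⁻¹' (T ∩ U) ∩ {q | 0 < q.2} ∈ 𝓝 ((0 : Fin k → ℝ), ρ) := by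
    refine Filter.inter_mem (hΨ.continuous.continuousAt.preimage_mem_nhds ?_)
      ((isOpen_lt continuous_const continuous_snd).mem_nhds hρ)
    rw [hΨp]
    exact Filter.inter_mem hT (hU.mem_nhds hpU)
  obtain ⟨ε, hε, hsub⟩ := Metric.nhds_basis_closedBall.mem_iff.1 hpre
  rw [← closedBall_prod_same] at hsub
  set box : Set ((Fin k → ℝ) × ℝ) := closedBall 0 ε ×ˢ closedBall ρ ε with hbox
  have hboxc : IsCompact box := (isCompact_closedBall _ _).prod (isCompact_closedBall _ _)
  have hboxm : MeasurableSet box := hboxc.isClosed.measurableSet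
  have hΘΨ : ∀ q ∈ box, Θ (Ψ q) = q := fun q hq => by
    obtain ⟨h1, h2⟩ := hinv q.1 q.2 (hsub hq).2
    exact Prod.ext h1 h2
  obtain ⟨M, hM⟩ := hboxc.exists_bound_of_continuousOn (hΨ.continuous_fderiv one_ne_zero).continuousOn
  obtain ⟨C, hC, hCle⟩ := exists_measure_image_le_of_lipschitzOnWith
    (E := Euc (k + 1)) (F := (Fin k → ℝ) × ℝ) (by simp)
    volume ((volume : Measure (Fin k → ℝ)).prod (volume : Measure ℝ)) Λ
  have hKc : IsCompact (Ψ '' box) := hboxc.image hΨ.continuous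
  have hmap : Measure.map Ψ (volume.restrict box) ≤ C • volume.restrict (Ψ '' box) := by
    refine Measure.le_iff.2 fun s hs => ?_
    rw [Measure.map_apply hΨ.continuous.measurable hs,
      Measure.restrict_apply (hΨ.continuous.measurable hs), Measure.smul_apply, smul_eq_mul,
      Measure.restrict_apply hs]
    refine le_trans (measure_mono ?_) (hCle Θ (s ∩ Ψ '' box) (hLip.mono ?_))
    · exact fun q hq => ⟨Ψ q, ⟨hq.1, mem_image_of_mem Ψ hq.2⟩, hΘΨ q hq.2⟩
    · rintro _ ⟨-, q, hq, rfl⟩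
      exact (hsub hq).1.1
  have hev : ∀ᶠ x in 𝓝 p, Θ x ∈ ball (Θ p) ε ∧ x ∈ T ∧ Ψ (Θ x) = x :=
    (hΘ.continuousAt.eventually (ball_mem_nhds _ hε)).and (Filter.Eventually.and hT hloc)
  obtain ⟨V, hV, hVo, hpV⟩ := _root_.eventually_nhds_iff.1 hev
  refine ⟨Ψ '' box, Ψ, closedBall ρ ε, ε, ENNReal.ofReal M * ‖ContinuousLinearMap.inl ℝ (Fin k → ℝ) ℝ‖ₑ,
    C, V, θ, Λ, hKc, ?_, hΨ, isClosed_closedBall.measurableSet, ?_, by finiteness, ?_, hC, ?_, hVo,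
    hpV, ?_, ?_⟩
  · rintro _ ⟨q, hq, rfl⟩
    exact (hsub hq).1.2
  · exact fun z hz r hr => mem_image_of_mem Ψ ⟨hz, hr⟩
  · intro z hz r hr
    have h1 : HasFDerivAt (fun z => Ψ (z, r))
        ((fderiv ℝ Ψ (z, r)).comp (ContinuousLinearMap.inl ℝ (Fin k → ℝ) ℝ)) z :=
      ((hΨ.differentiable one_ne_zero).differentiableAt.hasFDerivAt).comp z
        (hasFDerivAt_prodMk_left z r)
    rw [h1.fderiv]
    have h2 : ‖fderiv ℝ Ψ (z, r)‖ₑ ≤ ENNReal.ofReal M := by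
      rw [← ofReal_norm]
      exact ENNReal.ofReal_le_ofReal (hM _ ⟨hz, hr⟩)
    refine le_trans ?_ (mul_le_mul_left h2 _)
    simp only [← ofReal_norm]
    rw [← ENNReal.ofReal_mul (norm_nonneg _)]
    exact ENNReal.ofReal_le_ofReal (ContinuousLinearMap.opNorm_comp_le _ _)
  · intro h hh
    have hm : Measurable fun q => h (Ψ q) := hh.comp hΨ.continuous.measurable
    calc ∫⁻ r in closedBall ρ ε, ∫⁻ z in closedBall 0 ε, h (Ψ (z, r))
        = ∫⁻ q in box, h (Ψ q) := by
          rw [hbox, Measure.volume_eq_prod, ← Measure.prod_restrict,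
            lintegral_prod_symm _ hm.aemeasurable]
      _ = ∫⁻ x, h x ∂(Measure.map Ψ (volume.restrict box)) :=
          (lintegral_map hh hΨ.continuous.measurable).symm
      _ ≤ ∫⁻ x, h x ∂(C • volume.restrict (Ψ '' box)) := lintegral_mono' hmap le_rfl
      _ = _ := by rw [lintegral_smul_measure, smul_eq_mul]
  · have := LipschitzWith.prod_fst.comp_lipschitzOnWith (hLip.mono fun x hx => (hV x hx).2.1)
    rw [one_mul] at this
    exact this
  · intro x hx
    obtain ⟨h1, -, h3⟩ := hV x hx
    rw [hΘp, ← ball_prod_same] at h1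
    exact ⟨h1.1, ball_subset_closedBall h1.2, h3⟩

theorem exists_forall_measure_lt_of_absolutelyContinuous {α : Type*} [MeasurableSpace α]
    {μ ν : Measure α} [SigmaFinite μ] [IsFiniteMeasure ν] (h : ν ≪ μ) {ε : ℝ≥0∞} (hε : ε ≠ 0) :
    ∃ δ > 0, ∀ s, μ s < δ → ν s < ε := by
  have hfin : ∫⁻ x, ν.rnDeriv μ x ∂μ ≠ ∞ := (Measure.lintegral_rnDeriv_lt_top ν μ).ne
  obtain ⟨δ, hδ, hs⟩ := exists_pos_setLIntegral_lt_of_measure_lt hfin hε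
  refine ⟨δ, hδ, fun s hsδ => (measure_mono (subset_toMeasurable μ s)).trans_lt ?_⟩
  have := hs (toMeasurable μ s) (by rwa [measure_toMeasurable])
  rwa [Measure.setLIntegral_rnDeriv h] at this

/-- The conclusions of the theorem on the spheres around `x₀`, near a point `p ≠ x₀`. -/
theorem exists_isOpen_ae_hausdorffMeasure_image {m k : ℕ} (hk : 2 ≤ k) {U : Set (Euc (k + 1))}
    (hU : IsOpen U) {φ : ℝ → ℝ} (hφ : MonotoneOn φ (Ici 0))
    (hS : ∑' j, calderonCoeff k (dyadicWeight φ) j ≠ ∞) {f : Euc (k + 1) → Euc m}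
    (hf : ContinuousOn f U) {Df : Euc (k + 1) → (Euc (k + 1) →L[ℝ] Euc m)}
    (hD : MemOrliczSobolevWith φ U f Df) {x₀ p : Euc (k + 1)} (hpU : p ∈ U) (hp : p ≠ x₀) :
    ∃ V, IsOpen V ∧ p ∈ V ∧ ∀ᵐ r : ℝ,
      (∀ ε : ℝ, 0 < ε → ∃ δ : ℝ, 0 < δ ∧ ∀ B ⊆ sphere x₀ r ∩ V, μH[(k : ℝ)] B < ENNReal.ofReal δ →
        μH[(k : ℝ)] (f '' B) < ENNReal.ofReal ε) ∧
      ∀ E ⊆ sphere x₀ r ∩ V, (∀ x ∈ E, frobNorm (Df x) = 0) → μH[(k : ℝ)] (f '' E) = 0 := by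
  obtain ⟨K, Ψ, I, R, L, C, V, θ, Λ, hK, hKU, hΨ, hI, hΨK, hLt, hL, hC, hΨm, hV, hpV, hθ, hVθ⟩ :=
    exists_polar_chart hU hpU hp
  refine ⟨V, hV, hpV, ?_⟩
  filter_upwards [ae_exists_measure_image_le hk hU hφ hS hf hD hK hKU hΨ hI hΨK hLt hL hC hΨm]
    with r hr
  by_cases hrI : r ∈ I
  swap
  · have hempty : sphere x₀ r ∩ V = ∅ := by
      refine eq_empty_of_forall_notMem fun x hx => hrI ?_
      rw [← mem_sphere_iff_norm.1 hx.1]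
      exact (hVθ x hx.2).2.1
    rw [hempty]
    refine ⟨fun ε hε => ⟨1, one_pos, fun B hB _ => ?_⟩, fun E hE _ => ?_⟩
    · rw [subset_empty_iff.1 hB, image_empty, measure_empty]
      exact ENNReal.ofReal_pos.2 hε
    · rw [subset_empty_iff.1 hE, image_empty, measure_empty]
  obtain ⟨ν, hν, hνac, hνle, hν0⟩ := hr hrI
  have hΨθ : ∀ B ⊆ sphere x₀ r ∩ V, ∀ x ∈ B, Ψ (θ x, r) = x := fun B hB x hx => by
    have := (hVθ x (hB hx).2).2.2
    rwa [mem_sphere_iff_norm.1 (hB hx).1] at this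
  have hball : ∀ B ⊆ sphere x₀ r ∩ V, θ '' B ⊆ ball 0 R := by
    rintro B hB _ ⟨x, hx, rfl⟩
    exact (hVθ x (hB hx).2).1
  have himage : ∀ B ⊆ sphere x₀ r ∩ V, μH[(k : ℝ)] (f '' B) ≤ ν (θ '' B) := fun B hB => by
    refine le_of_eq_of_le ?_ (hνle _ (hball B hB))
    rw [image_image]
    congr 1
    exact image_congr fun x hx => by rw [hΨθ B hB x hx]
  refine ⟨fun ε hε => ?_, fun E hE hE0 => le_antisymm ((himage E hE).trans (hν0 _ (hball E hE) ?_).le)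
    zero_le⟩
  · obtain ⟨δ, hδ, hδε⟩ :=
      exists_forall_measure_lt_of_absolutelyContinuous hνac (ENNReal.ofReal_pos.2 hε).ne'
    have hΛ : (Λ : ℝ≥0∞) ^ (k : ℝ) ≠ ∞ := by finiteness
    obtain ⟨δ', hδ', hlt⟩ : ∃ δ' : ℝ, 0 < δ' ∧ (Λ : ℝ≥0∞) ^ (k : ℝ) * ENNReal.ofReal δ' < δ := by
      have ht : Filter.Tendsto (fun t : ℝ => (Λ : ℝ≥0∞) ^ (k : ℝ) * ENNReal.ofReal t) (𝓝[>] 0)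
          (𝓝 0) := by
        have h := ENNReal.Tendsto.const_mul (a := (Λ : ℝ≥0∞) ^ (k : ℝ))
          (ENNReal.continuous_ofReal.tendsto 0) (Or.inr hΛ)
        simp only [ENNReal.ofReal_zero, mul_zero] at h
        exact h.mono_left nhdsWithin_le_nhds
      obtain ⟨δ', h1, h2⟩ := ((ht.eventually (gt_mem_nhds hδ)).and self_mem_nhdsWithin).exists
      exact ⟨δ', h2, h1⟩
    refine ⟨δ', hδ', fun B hB hBδ => (himage B hB).trans_lt (hδε _ (lt_of_le_of_lt ?_ hlt))⟩
    have hvol : (volume : Measure (Fin k → ℝ)) = μH[(k : ℝ)] := by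
      simpa using (hausdorffMeasure_pi_real (ι := Fin k)).symm
    rw [hvol]
    exact ((hθ.mono fun x hx => (hB hx).2).hausdorffMeasure_image_le (Nat.cast_nonneg k)).trans
      (by gcongr)
  · rintro _ ⟨x, hx, rfl⟩
    rw [hΨθ E hE x hx]
    exact hE0 x hx

theorem stmt3 {n m : ℕ} (hn : 3 ≤ n) (hm : 1 ≤ m) (U : Set (Euc n)) (hU : IsOpen U)
    (x₀ : Euc n)
    (φ : ℝ → ℝ) (hφmono : MonotoneOn φ (Ici 0)) (hφpos : ∀ t ∈ Ici (0:ℝ), 0 ≤ φ t)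
    (hCald : CalderonCondition n φ)
    (f : Euc n → Euc m) (hfc : ContinuousOn f U)
    (Df : Euc n → (Euc n →L[ℝ] Euc m)) (hfW : MemOrliczSobolevWith φ U f Df) :
    ∀ᵐ r : ℝ ∂volume, 0 < r →
      LusinNOn f (Metric.sphere x₀ r ∩ U) ((n : ℝ) - 1) ∧
      LocAbsContOn f (Metric.sphere x₀ r ∩ U) ((n : ℝ) - 1) ∧
      ∀ E ⊆ Metric.sphere x₀ r ∩ U, (∀ x ∈ E, frobNorm (Df x) = 0) →
        μH[(n : ℝ) - 1] (f '' E) = 0 := by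
  obtain ⟨k, rfl⟩ : ∃ k, n = k + 1 := ⟨n - 1, by omega⟩
  have hk : 2 ≤ k := by omega
  have hk1 : ((k + 1 : ℕ) : ℝ) - 1 = k := by push_cast; ring
  have hk2 : ((k + 1 : ℕ) : ℝ) - 2 = k - 1 := by push_cast; ring
  rw [CalderonCondition, hk2] at hCald
  rw [hk1]
  have hS := tsum_calderonCoeff_ne_top hk hφmono hCald
  choose! V hVo hpV hV using fun (p : Euc (k + 1)) (hp : p ∈ U \ {x₀}) =>
    exists_isOpen_ae_hausdorffMeasure_image hk hU hφmono hS hfc hfW hp.1 hp.2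
  obtain ⟨T, hTU, hTc, hT⟩ := TopologicalSpace.countable_cover_nhdsWithin
    (s := U \ {x₀}) fun p hp => mem_nhdsWithin_of_mem_nhds ((hVo p hp).mem_nhds (hpV p hp))
  have hae := (ae_ball_iff hTc).2 fun p hp => hV p (hTU hp)
  filter_upwards [hae] with r hr hr0
  have hcover : ∀ x ∈ sphere x₀ r ∩ U, ∃ p ∈ T, x ∈ V p := fun x hx => by
    have hx0 : x ≠ x₀ := ne_of_mem_sphere hx.1 hr0.ne'
    simpa using hT ⟨hx.2, hx0⟩
  have hnull : ∀ B ⊆ sphere x₀ r ∩ U, (∀ p ∈ T, μH[(k : ℝ)] (f '' (B ∩ V p)) = 0) →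
      μH[(k : ℝ)] (f '' B) = 0 := fun B hB h0 => by
    refine measure_mono_null ?_ ((measure_biUnion_null_iff hTc).2 h0)
    rintro _ ⟨x, hx, rfl⟩
    obtain ⟨p, hp, hxp⟩ := hcover x (hB hx)
    exact mem_biUnion hp (mem_image_of_mem f ⟨hx, hxp⟩)
  have hsub : ∀ B ⊆ sphere x₀ r ∩ U, ∀ p, B ∩ V p ⊆ sphere x₀ r ∩ V p := fun B hB p x hx =>
    ⟨(hB hx.1).1, hx.2⟩
  refine ⟨fun B hB hB0 => hnull B hB fun p hp => ?_, fun x hx => ?_, fun E hE hE0 =>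
    hnull E hE fun p hp => (hr p hp).2 _ (hsub E hE p) fun x hx => hE0 x hx.1⟩
  · by_contra h
    obtain ⟨ε, hε, hlt⟩ : ∃ ε : ℝ, 0 < ε ∧ ENNReal.ofReal ε < μH[(k : ℝ)] (f '' (B ∩ V p)) := by
      obtain ⟨c, hc0, hc⟩ := ENNReal.lt_iff_exists_nnreal_btwn.1 (pos_iff_ne_zero.2 h)
      exact ⟨c, by exact_mod_cast hc0, by rwa [ENNReal.ofReal_coe_nnreal]⟩
    obtain ⟨δ, hδ, hδε⟩ := (hr p hp).1 ε hε
    refine hlt.not_gt (hδε _ (hsub B hB p) ?_)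
    rw [measure_mono_null inter_subset_left hB0]
    exact ENNReal.ofReal_pos.2 hδ
  · obtain ⟨p, hp, hxp⟩ := hcover x hx
    refine ⟨V p, hVo p (hTU hp), hxp, fun ε hε => ?_⟩
    obtain ⟨δ, hδ, hδε⟩ := (hr p hp).1 ε hε
    exact ⟨δ, hδ, fun B hB => hδε B fun x hx => ⟨(hB hx).1.1, (hB hx).2⟩⟩
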